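/- Fix γ ∈ [0,1/2) and n, m ∈ ℕ with n > m. Let ε ≤ 2^{−m−1}, let Δ ∈ (0,1) be such that μ_γ + Δ < 1, and let 0 < c < 1. If f is drawn uniformly at random from F*_ε, then with probability at least 1 − 2^{−m·2^{n − c·m·log₂(1/(μ_γ+Δ))}} the function f has the following property: for every q ∈ ℕ with 2q < n − c·m·log₂(1/(μ_γ+Δ)) + log₂( (1−(μ_γ+Δ)^{1−c}) · log₂((μ_γ+Δ)/μ_γ) / (8·log₂(1/Δ)) ), every q-qubit strategy T for QPV_rout^{f:n→m} satisfies ω_T ≤ (μ_γ+Δ)^{c·m} · (1 + 3·√(3·ln(2/ε))·2^{−n+m/2}) + 21·Δ^m. -/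

import Mathlib

open Matrix Kronecker Finset
open scoped ComplexOrder

noncomputable section

/-- Bit strings of length `n`. -/
abbrev Bits (n : ℕ) := Fin n → Bool

/-- Binary entropy function `h(p) = -p log₂ p - (1-p) log₂ (1-p)` (with `h 0 = 0`). -/
def binEnt (p : ℝ) : ℝ := -(p * Real.logb 2 p) - (1 - p) * Real.logb 2 (1 - p)

/-- `μ_γ = 2^{γ+h(γ)} (1/2 + 1/(2√2))`. -/
def muGamma (γ : ℝ) : ℝ := (2 : ℝ) ^ (γ + binEnt γ) * (1 / 2 + 1 / (2 * Real.sqrt 2))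

/-- The EPR pair `Φ⁺ = (|00⟩+|11⟩)/√2 ∈ ℂ² ⊗ ℂ²`. -/
def phiPlus : Bool × Bool → ℂ := fun p => if p.1 = p.2 then (1 / (Real.sqrt 2 : ℂ)) else 0

/-- The rank-one projector `|Φ⁺⟩⟨Φ⁺|`. -/
def projPhiPlus : Matrix (Bool × Bool) (Bool × Bool) ℂ :=
  Matrix.vecMulVec phiPlus (star phiPlus)

/-- The two-qubit measurement operator: `|Φ⁺⟩⟨Φ⁺|` for outcome `a = 0`,
`I − |Φ⁺⟩⟨Φ⁺|` for outcome `a = 1`. -/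
def Nbit (a : Bool) : Matrix (Bool × Bool) (Bool × Bool) ℂ :=
  if a then 1 - projPhiPlus else projPhiPlus

/-- `N^z_a` on `V ⊗ A' ⊗ B'` with `V = (ℂ²)^{⊗m}`, `A' = (ℂ²)^{⊗m} ⊗ E_A`,
`B' = (ℂ²)^{⊗m} ⊗ E_B`: for each `i`, acts on the `i`-th qubit of `V` together with the
`i`-th output qubit of `A'` (if `z_i = 0`) or of `B'` (if `z_i = 1`) as `Nbit (a i)`,
and as the identity elsewhere. -/
def Nmat (m : ℕ) {EA EB : Type*} [DecidableEq EA] [DecidableEq EB] (z a : Bits m) :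
    Matrix (Bits m × (Bits m × EA) × (Bits m × EB))
      (Bits m × (Bits m × EA) × (Bits m × EB)) ℂ :=
  fun r c =>
    (if r.2.1.2 = c.2.1.2 then 1 else 0) * (if r.2.2.2 = c.2.2.2 then 1 else 0) *
      ∏ i : Fin m,
        (if z i then
          (if r.2.1.1 i = c.2.1.1 i then 1 else 0) *
            Nbit (a i) (r.1 i, r.2.2.1 i) (c.1 i, c.2.2.1 i)
        else
          (if r.2.2.1 i = c.2.2.1 i then 1 else 0) *
            Nbit (a i) (r.1 i, r.2.1.1 i) (c.1 i, c.2.1.1 i))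

/-- Hamming weight of a bit string. -/
def hw {m : ℕ} (a : Bits m) : ℕ := (Finset.univ.filter (fun i => a i = true)).card

/-- The state `Ψ_{xy} = (I_V ⊗ K^{xy} ⊗ L^{xy})ψ`. -/
def routPsi (n m eA eB : ℕ)
    (ψ : Bits m × (Bits m × Fin eA) × (Bits m × Fin eB) → ℂ)
    (K : Bits n → Bits n → Matrix (Bits m × Fin eA) (Bits m × Fin eA) ℂ)
    (L : Bits n → Bits n → Matrix (Bits m × Fin eB) (Bits m × Fin eB) ℂ)
    (x y : Bits n) : Bits m × (Bits m × Fin eA) × (Bits m × Fin eB) → ℂ :=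
  ((1 : Matrix (Bits m) (Bits m) ℂ) ⊗ₖ (K x y ⊗ₖ L x y)).mulVec ψ

/-- `q_f(z)`: the fraction of input pairs `(x,y)` mapped by `f` to `z`. -/
def qf (n m : ℕ) (f : Bits n × Bits n → Bits m) (z : Bits m) : ℝ :=
  ((Finset.univ.filter (fun p : Bits n × Bits n => f p = z)).card : ℝ) / 2 ^ (2 * n)

/-- The set `F*_ε` of functions whose output distribution is close to uniform. -/
def Fstar (n m : ℕ) (ε : ℝ) : Set (Bits n × Bits n → Bits m) :=
  {f | ∀ z : Bits m,
    |qf n m f z - (2 : ℝ) ^ (-(m : ℝ))| ≤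
      Real.sqrt (3 * Real.log (2 / ε)) * (2 : ℝ) ^ (-(n : ℝ) - m / 2)}

/-- Split a bit string of length `p + q` into its two halves. -/
def splitBits {p q : ℕ} (w : Bits (p + q)) : Bits p × Bits q :=
  (fun i => w (Fin.castAdd q i), fun j => w (Fin.natAdd p j))

/-- Transport a bit string along an equality of lengths. -/
def castBits {p q : ℕ} (h : p = q) (w : Bits p) : Bits q := fun i => w (Fin.cast h.symm i)

/-- A `q`-qubit strategy for `QPV_rout^{f:n→m}`: a splitting of `q` qubits on each side
into kept/communicated registers, a shared state `φ`, local unitaries `U^x`, `V^y`, and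
response unitaries `K^{xy}`, `L^{xy}` on the regrouped registers
`A' = A_k ⊗ B_c ≅ (ℂ²)^{⊗m} ⊗ (ℂ²)^{⊗rA}`, `B' = B_k ⊗ A_c ≅ (ℂ²)^{⊗m} ⊗ (ℂ²)^{⊗rB}`,
whose first `m` qubit factors are the designated output registers. -/
structure RoutStrategy (n m q : ℕ) where
  qAk : ℕ
  qAc : ℕ
  qBk : ℕ
  qBc : ℕ
  rA : ℕ
  rB : ℕ
  hqA : qAk + qAc = q
  hqB : qBk + qBc = q
  hrA : qAk + qBc = m + rA
  hrB : qBk + qAc = m + rB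
  φ : Bits m × (Bits qAk × Bits qAc) × (Bits qBk × Bits qBc) → ℂ
  hφ : ∑ i, ‖φ i‖ ^ 2 = 1
  U : Bits n → Matrix (Bits qAk × Bits qAc) (Bits qAk × Bits qAc) ℂ
  V : Bits n → Matrix (Bits qBk × Bits qBc) (Bits qBk × Bits qBc) ℂ
  hU : ∀ x, U x ∈ Matrix.unitaryGroup (Bits qAk × Bits qAc) ℂ
  hV : ∀ y, V y ∈ Matrix.unitaryGroup (Bits qBk × Bits qBc) ℂ
  K : Bits n → Bits n → Matrix (Bits qAk × Bits qBc) (Bits qAk × Bits qBc) ℂ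
  L : Bits n → Bits n → Matrix (Bits qBk × Bits qAc) (Bits qBk × Bits qAc) ℂ
  hK : ∀ x y, K x y ∈ Matrix.unitaryGroup (Bits qAk × Bits qBc) ℂ
  hL : ∀ x y, L x y ∈ Matrix.unitaryGroup (Bits qBk × Bits qAc) ℂ

/-- The state `Ψ_{xy} = (I_V ⊗ K^{xy} ⊗ L^{xy})(I_V ⊗ U^x ⊗ V^y)φ`, viewed in
`V ⊗ A' ⊗ B'` via the canonical reordering and regrouping of tensor factors. -/
def RoutStrategy.Psi {n m q : ℕ} (T : RoutStrategy n m q) (x y : Bits n) :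
    Bits m × (Bits m × Bits T.rA) × (Bits m × Bits T.rB) → ℂ :=
  fun p =>
    (((1 : Matrix (Bits m) (Bits m) ℂ) ⊗ₖ (T.K x y ⊗ₖ T.L x y)).mulVec
        (fun u : Bits m × (Bits T.qAk × Bits T.qBc) × (Bits T.qBk × Bits T.qAc) =>
          (((1 : Matrix (Bits m) (Bits m) ℂ) ⊗ₖ (T.U x ⊗ₖ T.V y)).mulVec T.φ)
            (u.1, (u.2.1.1, u.2.2.2), (u.2.2.1, u.2.1.2))))
      (p.1, splitBits (castBits T.hrA.symm (Fin.append p.2.1.1 p.2.1.2)),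
        splitBits (castBits T.hrB.symm (Fin.append p.2.2.1 p.2.2.2)))

/-- The winning probability `ω_T` of a routing strategy, with error tolerance `γ`. -/
def RoutStrategy.win {n m q : ℕ} (T : RoutStrategy n m q) (γ : ℝ)
    (f : Bits n × Bits n → Bits m) : ℝ :=
  (1 / 2 ^ (2 * n) : ℝ) * ∑ x : Bits n, ∑ y : Bits n,
    ∑ a ∈ Finset.univ.filter (fun a : Bits m => (hw a : ℝ) ≤ γ * m),
      (star (T.Psi x y) ⬝ᵥ (Nmat m (f (x, y)) a).mulVec (T.Psi x y)).re

section Hilbert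

variable {E : Type*} [NormedAddCommGroup E] [InnerProductSpace ℂ E] [CompleteSpace E]

theorem inner_selfAdjoint_left {P : E →L[ℂ] E} (hP : IsSelfAdjoint P) (u v : E) :
    inner ℂ (P u) v = inner ℂ u (P v) := by
  conv_lhs => rw [← hP.adjoint_eq]
  exact ContinuousLinearMap.adjoint_inner_left P v u

theorem norm_sq_apply_of_isProj {P : E →L[ℂ] E} (hP : IsSelfAdjoint P) (hPP : P * P = P) (u : E) :
    (inner ℂ u (P u) : ℂ) = (‖P u‖ ^ 2 : ℝ) := by
  have : P (P u) = P u := congrArg (fun T : E →L[ℂ] E => T u) hPP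
  rw [← this, ← inner_selfAdjoint_left hP, inner_self_eq_norm_sq_to_K, this]
  simp

/-- Vectors fixed by two families of projections that are unbiased index by index
(`P i * Q i * P i = P i / 4`) and commute across indices are almost orthogonal. -/
theorem norm_inner_le_of_unbiased {ι : Type*} [DecidableEq ι] (P Q : ι → E →L[ℂ] E)
    (hP : ∀ i, IsSelfAdjoint (P i)) (hQ : ∀ i, IsSelfAdjoint (Q i))
    (hQQ : ∀ i, Q i * Q i = Q i)
    (hPQP : ∀ i, P i * Q i * P i = (1 / 4 : ℂ) • P i)
    (hcomm : ∀ i j, i ≠ j → Commute (P i) (Q j)) (D : Finset ι) :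
    ∀ u v : E, (∀ i ∈ D, P i u = u) → (∀ i ∈ D, Q i v = v) →
      ‖(inner ℂ u v : ℂ)‖ ≤ (1 / 2) ^ D.card * (‖u‖ * ‖v‖) := by
  induction D using Finset.induction_on with
  | empty => intro u v _ _; simpa using norm_inner_le_norm u v
  | insert i D hi ih =>
    intro u v hu hv
    have hui : P i u = u := hu i (Finset.mem_insert_self _ _)
    have hnorm : ‖Q i u‖ = 1 / 2 * ‖u‖ := by
      have h1 := norm_sq_apply_of_isProj (hQ i) (hQQ i) u
      have h2 : (inner ℂ u (Q i u) : ℂ) = ((1 / 4 * ‖u‖ ^ 2 : ℝ) : ℂ) := by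
        have h3 : P i (Q i (P i u)) = (1 / 4 : ℂ) • P i u :=
          congrArg (fun T : E →L[ℂ] E => T u) (hPQP i)
        rw [hui] at h3
        have h4 : (inner ℂ u (Q i u) : ℂ) = inner ℂ u (P i (Q i u)) := by
          rw [← inner_selfAdjoint_left (hP i), hui]
        rw [h4, h3, inner_smul_right, inner_self_eq_norm_sq_to_K]
        push_cast; rfl
      rw [h1] at h2
      have h3 : ‖Q i u‖ ^ 2 = (1 / 2 * ‖u‖) ^ 2 := by
        have := Complex.ofReal_injective h2
        rw [this]; ring
      exact (pow_left_inj₀ (norm_nonneg _) (by positivity) two_ne_zero).1 h3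
    have hinner : (inner ℂ u v : ℂ) = inner ℂ (Q i u) v := by
      rw [inner_selfAdjoint_left (hQ i), hv i (Finset.mem_insert_self _ _)]
    rw [hinner, Finset.card_insert_of_notMem hi]
    have := ih (Q i u) v (fun j hj => by
        have hji : j ≠ i := fun h => hi (h ▸ hj)
        have h := congrArg (fun T : E →L[ℂ] E => T u) (hcomm j i hji).eq
        have h' : P j (Q i u) = Q i (P j u) := h
        rw [h', hu j (Finset.mem_insert_of_mem hj)])
      (fun j hj => hv j (Finset.mem_insert_of_mem hj))
    rw [hnorm] at this
    calc _ ≤ _ := this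
      _ = _ := by ring

/-- A Schur-test bound on a sum of projections with small pairwise overlaps. -/
theorem sum_norm_sq_le_of_overlap {ι : Type*} [Fintype ι] (P : ι → E →L[ℂ] E)
    (hP : ∀ i, IsSelfAdjoint (P i)) (hPP : ∀ i, P i * P i = P i)
    (c : ι → ι → ℝ) (hc : ∀ i j, c i j = c j i) (hc0 : ∀ i j, 0 ≤ c i j)
    (hov : ∀ i j u v, P i u = u → P j v = v → ‖(inner ℂ u v : ℂ)‖ ≤ c i j * (‖u‖ * ‖v‖))
    (C : ℝ) (hC : ∀ i, ∑ j, c i j ≤ C) (hC0 : 0 ≤ C) (ψ : E) (hψ : ‖ψ‖ ≤ 1) :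
    ∑ i, ‖P i ψ‖ ^ 2 ≤ C := by
  set S := ∑ i, ‖P i ψ‖ ^ 2 with hS
  have hS0 : 0 ≤ S := Finset.sum_nonneg fun i _ => by positivity
  have h1 : (S : ℂ) = inner ℂ ψ (∑ i, P i ψ) := by
    rw [inner_sum, hS]; push_cast
    exact Finset.sum_congr rfl fun i _ => by
      rw [norm_sq_apply_of_isProj (hP i) (hPP i)]; push_cast; rfl
  have h2 : S ≤ ‖∑ i, P i ψ‖ := by
    have : ‖(S : ℂ)‖ ≤ ‖ψ‖ * ‖∑ i, P i ψ‖ := h1 ▸ norm_inner_le_norm _ _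
    rw [Complex.norm_real, Real.norm_of_nonneg hS0] at this
    exact this.trans (mul_le_of_le_one_left (norm_nonneg _) hψ)
  have hfix : ∀ i, P i (P i ψ) = P i ψ := fun i => congrArg (fun T : E →L[ℂ] E => T ψ) (hPP i)
  have h3 : ‖∑ i, P i ψ‖ ^ 2 ≤ C * S := by
    have h4 : ((‖∑ i, P i ψ‖ ^ 2 : ℝ) : ℂ) = ∑ i, ∑ j, inner ℂ (P i ψ) (P j ψ) := by
      have := inner_self_eq_norm_sq_to_K (𝕜 := ℂ) (∑ i, P i ψ)
      rw [sum_inner] at this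
      simp_rw [inner_sum] at this
      rw [this]; push_cast; rfl
    have h5 : ‖((‖∑ i, P i ψ‖ ^ 2 : ℝ) : ℂ)‖ ≤
        ∑ i, ∑ j, c i j * ((‖P i ψ‖ ^ 2 + ‖P j ψ‖ ^ 2) / 2) := by
      rw [h4]
      refine (norm_sum_le _ _).trans (Finset.sum_le_sum fun i _ => (norm_sum_le _ _).trans
        (Finset.sum_le_sum fun j _ => (hov i j _ _ (hfix i) (hfix j)).trans ?_))
      refine mul_le_mul_of_nonneg_left ?_ (hc0 i j)
      nlinarith [sq_nonneg (‖P i ψ‖ - ‖P j ψ‖)]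
    rw [Complex.norm_real, Real.norm_of_nonneg (by positivity)] at h5
    refine h5.trans ?_
    have h6 : ∑ i, ∑ j, c i j * ((‖P i ψ‖ ^ 2 + ‖P j ψ‖ ^ 2) / 2) =
        ∑ i, ‖P i ψ‖ ^ 2 * ∑ j, c i j := by
      have e1 : ∀ i j, c i j * ((‖P i ψ‖ ^ 2 + ‖P j ψ‖ ^ 2) / 2) =
          ‖P i ψ‖ ^ 2 * c i j / 2 + ‖P j ψ‖ ^ 2 * c j i / 2 := fun i j => by
        rw [hc j i]; ring
      simp_rw [e1, Finset.sum_add_distrib]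
      rw [Finset.sum_comm (f := fun i j => ‖P j ψ‖ ^ 2 * c j i / 2), ← Finset.sum_add_distrib]
      refine Finset.sum_congr rfl fun i _ => ?_
      rw [← Finset.sum_add_distrib, Finset.mul_sum]
      exact Finset.sum_congr rfl fun j _ => by ring
    rw [h6, hS, Finset.mul_sum]
    refine Finset.sum_le_sum fun i _ => ?_
    rw [mul_comm]
    exact mul_le_mul_of_nonneg_right (hC i) (by positivity)
  by_contra hlt
  push Not at hlt
  nlinarith [norm_nonneg (∑ i, P i ψ)]

end Hilbert

section MatrixUnits

variable {R : Type*} [Ring R] [StarRing R] [Algebra ℂ R]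

/-- A self-adjoint `2 × 2` system of matrix units in a star ring. -/
structure IsMatrixUnits (x : Bool → Bool → R) : Prop where
  mul : ∀ s t u v, x s t * x u v = if t = u then x s v else 0
  one : x false false + x true true = 1
  adj : ∀ s t, star (x s t) = x t s

/-- The projection onto the maximally entangled state of two commuting qubits given by
their matrix units. -/
def entProj (x a : Bool → Bool → R) : R :=
  (1 / 2 : ℂ) • ∑ s, ∑ t, x s t * a s t

variable {x a b : Bool → Bool → R}

theorem isSelfAdjoint_entProj [StarModule ℂ R] (hx : IsMatrixUnits x) (ha : IsMatrixUnits a)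
    (hxa : ∀ s t u v, Commute (x s t) (a u v)) : IsSelfAdjoint (entProj x a) := by
  have h : ∀ s t, star (x s t * a s t) = x t s * a t s := fun s t => by
    rw [star_mul, hx.adj, ha.adj, (hxa _ _ _ _).eq]
  have h2 : star (1 / 2 : ℂ) = 1 / 2 := by simp
  rw [IsSelfAdjoint, entProj, star_smul, h2]
  simp only [star_sum, h]
  rw [Finset.sum_comm]

theorem entProj_mul_self (hx : IsMatrixUnits x) (ha : IsMatrixUnits a)
    (hxa : ∀ s t u v, Commute (x s t) (a u v)) :
    entProj x a * entProj x a = entProj x a := by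
  have h : ∀ s t u v, x s t * a s t * (x u v * a u v) =
      if t = u then x s v * a s v else 0 := fun s t u v => by
    rw [mul_assoc, ← mul_assoc (a s t), ← (hxa u v s t).eq, mul_assoc, ← mul_assoc, hx.mul, ha.mul]
    split_ifs <;> simp
  simp only [entProj, smul_mul_smul_comm, Fintype.sum_bool, mul_add, add_mul, h]
  simp only [if_true, if_false, Bool.true_eq_false, Bool.false_eq_true]
  module

theorem entProj_unbiased (hx : IsMatrixUnits x) (ha : IsMatrixUnits a) (hb : IsMatrixUnits b)
    (hxa : ∀ s t u v, Commute (x s t) (a u v)) (hxb : ∀ s t u v, Commute (x s t) (b u v))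
    (hab : ∀ s t u v, Commute (a s t) (b u v)) :
    entProj x a * entProj x b * entProj x a = (1 / 4 : ℂ) • entProj x a := by
  have h : ∀ s t u v w y, x s t * a s t * (x u v * b u v) * (x w y * a w y) =
      if t = u then if v = w then if t = w then x s y * a s y * b u v else 0 else 0 else 0 :=
    fun s t u v w y => by
    have : x s t * a s t * (x u v * b u v) * (x w y * a w y) =
        (x s t * x u v * x w y) * ((a s t * a w y) * b u v) := by
      calc _ = x s t * (a s t * x u v) * (b u v * x w y) * a w y := by simp only [mul_assoc]
        _ = x s t * x u v * (a s t * x w y) * (b u v * a w y) := by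
          rw [← (hxa u v s t).eq, ← (hxb w y u v).eq]; simp only [mul_assoc]
        _ = _ := by rw [← (hxa w y s t).eq, ← (hab w y u v).eq]; simp only [mul_assoc]
    rw [this, hx.mul, ha.mul]
    split_ifs with h1 h2 h3 h3 <;> simp [hx.mul, *, mul_assoc]
  have h1 : ∀ s y, x s y * a s y * b false false = x s y * a s y - x s y * a s y * b true true :=
    fun s y => by rw [eq_sub_iff_add_eq, ← mul_add, hb.one, mul_one]
  simp only [entProj, smul_mul_smul_comm, Fintype.sum_bool, mul_add, add_mul, h]
  simp only [if_true, if_false, Bool.true_eq_false, Bool.false_eq_true]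
  simp only [h1]
  module

end MatrixUnits

theorem commute_entProj {R : Type*} [Ring R] [Algebra ℂ R] {x y a b : Bool → Bool → R}
    (hxy : ∀ s t u v, Commute (x s t) (y u v)) (hxb : ∀ s t u v, Commute (x s t) (b u v))
    (hya : ∀ s t u v, Commute (y s t) (a u v)) (hab : ∀ s t u v, Commute (a s t) (b u v)) :
    Commute (entProj x a) (entProj y b) := by
  refine Commute.smul_left (Commute.smul_right ?_ _) _
  refine Commute.sum_left _ _ _ fun s _ => Commute.sum_left _ _ _ fun t _ =>
    Commute.sum_right _ _ _ fun u _ => Commute.sum_right _ _ _ fun v _ => ?_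
  exact ((hxy _ _ _ _).mul_right (hxb _ _ _ _)).mul_left
    ((hya _ _ _ _).symm.mul_right (hab _ _ _ _))

section Tensor

/-- The tensor product of `m` matrices of the same size. -/
def tens {m : ℕ} {T : Type*} (M : Fin m → Matrix T T ℂ) : Matrix (Fin m → T) (Fin m → T) ℂ :=
  fun r c => ∏ i, M i (r i) (c i)

variable {m : ℕ} {T : Type*}

theorem tens_mul [Fintype T] (M M' : Fin m → Matrix T T ℂ) :
    tens M * tens M' = tens (fun i => M i * M' i) := by
  ext r c
  simp only [Matrix.mul_apply, tens]
  rw [Finset.prod_univ_sum, Fintype.piFinset_univ]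
  simp only [Finset.prod_mul_distrib]

theorem tens_conjTranspose (M : Fin m → Matrix T T ℂ) :
    (tens M)ᴴ = tens (fun i => (M i)ᴴ) := by
  ext r c
  simp [tens, Matrix.conjTranspose_apply]

theorem tens_one [DecidableEq T] : tens (1 : Fin m → Matrix T T ℂ) = 1 := by
  ext r c
  simp only [tens, Pi.one_apply, Matrix.one_apply, Finset.prod_ite_zero, Finset.prod_const_one,
    funext_iff, Finset.mem_univ, true_imp_iff]

theorem tens_eq_zero (M : Fin m → Matrix T T ℂ) (i : Fin m) (h : M i = 0) :
    tens M = 0 := by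
  ext r c
  exact Finset.prod_eq_zero (Finset.mem_univ i) (by simp [h])

theorem tens_mulSingle_apply [DecidableEq T] (i : Fin m) (X : Matrix T T ℂ) (r c : Fin m → T) :
    tens (Pi.mulSingle i X) r c =
      X (r i) (c i) * if ∀ j, j ≠ i → r j = c j then 1 else 0 := by
  simp only [tens]
  rw [← Finset.mul_prod_erase _ _ (Finset.mem_univ i), Pi.mulSingle_eq_same]
  congr 1
  rw [Finset.prod_congr rfl (g := fun j => if r j = c j then (1 : ℂ) else 0)
    (fun j hj => by
      rw [Pi.mulSingle_eq_of_ne (Finset.ne_of_mem_erase hj), Matrix.one_apply]),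
    Finset.prod_ite_zero]
  simp

/-- The matrix unit `|s⟩⟨t|` on the `i`-th qubit. -/
def bitUnit (i : Fin m) (s t : Bool) : Matrix (Bits m) (Bits m) ℂ :=
  tens (Pi.mulSingle i (Matrix.single s t 1))

theorem tens_mulSingle_mul [Fintype T] [DecidableEq T] (i : Fin m) (X Y : Matrix T T ℂ) :
    tens (Pi.mulSingle i X) * tens (Pi.mulSingle i Y) = tens (Pi.mulSingle i (X * Y)) := by
  rw [tens_mul, Pi.mulSingle_mul]; rfl

theorem tens_mulSingle_commute [Fintype T] [DecidableEq T] {i j : Fin m} (h : i ≠ j)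
    (X Y : Matrix T T ℂ) :
    Commute (tens (Pi.mulSingle i X)) (tens (Pi.mulSingle j Y)) := by
  have := Pi.mulSingle_commute (f := fun _ : Fin m => Matrix T T ℂ) h X Y
  rw [commute_iff_eq, tens_mul, tens_mul]
  exact congrArg tens this.eq

theorem isMatrixUnits_bitUnit (i : Fin m) : IsMatrixUnits (bitUnit i) where
  mul s t u v := by
    rw [bitUnit, bitUnit, tens_mulSingle_mul]
    split_ifs with h
    · subst h; rw [Matrix.single_mul_single_same, one_mul]; rfl
    · rw [Matrix.single_mul_single_of_ne _ _ _ _ h]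
      exact tens_eq_zero _ i (by simp)
  one := by
    rw [← tens_one]
    ext r c
    simp only [bitUnit, Matrix.add_apply, tens_mulSingle_apply, ← add_mul]
    rw [← Matrix.add_apply]
    have : (Matrix.single false false 1 + Matrix.single true true 1 : Matrix Bool Bool ℂ) = 1 := by
      ext s t; cases s <;> cases t <;> simp [Matrix.single]
    rw [this, ← tens_mulSingle_apply, Pi.mulSingle_one]
  adj s t := by
    rw [Matrix.star_eq_conjTranspose, bitUnit, tens_conjTranspose]
    congr 1
    ext1 j
    by_cases h : j = i
    · subst h; simp
    · simp [Pi.mulSingle_eq_of_ne h]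

end Tensor

section Units

variable {ι κ : Type*} [Fintype ι] [DecidableEq ι] [Fintype κ] [DecidableEq κ]

theorem IsMatrixUnits.kronecker_one {x : Bool → Bool → Matrix ι ι ℂ} (hx : IsMatrixUnits x) :
    IsMatrixUnits (fun s t => x s t ⊗ₖ (1 : Matrix κ κ ℂ)) where
  mul s t u v := by
    rw [← Matrix.mul_kronecker_mul, hx.mul, one_mul]; split_ifs <;> simp
  one := by rw [← Matrix.add_kronecker, hx.one, Matrix.one_kronecker_one]
  adj s t := by
    rw [Matrix.star_eq_conjTranspose, Matrix.conjTranspose_kronecker, Matrix.conjTranspose_one,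
      ← Matrix.star_eq_conjTranspose, hx.adj]

theorem IsMatrixUnits.one_kronecker {x : Bool → Bool → Matrix ι ι ℂ} (hx : IsMatrixUnits x) :
    IsMatrixUnits (fun s t => (1 : Matrix κ κ ℂ) ⊗ₖ x s t) where
  mul s t u v := by
    rw [← Matrix.mul_kronecker_mul, hx.mul, one_mul]; split_ifs <;> simp
  one := by rw [← Matrix.kronecker_add, hx.one, Matrix.one_kronecker_one]
  adj s t := by
    rw [Matrix.star_eq_conjTranspose, Matrix.conjTranspose_kronecker, Matrix.conjTranspose_one,
      ← Matrix.star_eq_conjTranspose (x s t), hx.adj]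

theorem IsMatrixUnits.conj {x : Bool → Bool → Matrix ι ι ℂ} (hx : IsMatrixUnits x)
    {K : Matrix ι ι ℂ} (hK : K ∈ Matrix.unitaryGroup ι ℂ) :
    IsMatrixUnits (fun s t => star K * x s t * K) where
  mul s t u v := by
    have : star K * x s t * K * (star K * x u v * K) =
        star K * (x s t * ((K * star K) * x u v)) * K := by simp only [mul_assoc]
    rw [this, Matrix.mem_unitaryGroup_iff.1 hK, one_mul, hx.mul]
    split_ifs <;> simp
  one := by
    rw [← add_mul, ← mul_add, hx.one, mul_one, Matrix.mem_unitaryGroup_iff'.1 hK]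
  adj s t := by
    rw [star_mul, star_mul, star_star, hx.adj, mul_assoc]

theorem commute_kronecker_one_one_kronecker (X : Matrix ι ι ℂ) (Y : Matrix κ κ ℂ) :
    Commute (X ⊗ₖ (1 : Matrix κ κ ℂ)) ((1 : Matrix ι ι ℂ) ⊗ₖ Y) := by
  rw [commute_iff_eq, ← Matrix.mul_kronecker_mul, ← Matrix.mul_kronecker_mul]
  simp

end Units

section Measurement

theorem projPhiPlus_apply (p q : Bool × Bool) :
    projPhiPlus p q = if p.1 = p.2 ∧ q.1 = q.2 then 1 / 2 else 0 := by
  have h2 : ((Real.sqrt 2 : ℝ) : ℂ) * ((Real.sqrt 2 : ℝ) : ℂ) = 2 := by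
    rw [← Complex.ofReal_mul, Real.mul_self_sqrt (by norm_num)]; norm_num
  have h : (1 / (Real.sqrt 2 : ℂ)) * (1 / (Real.sqrt 2 : ℂ)) = 1 / 2 := by
    rw [div_mul_div_comm, h2, one_mul]
  simp only [projPhiPlus, Matrix.vecMulVec_apply, Pi.star_apply, phiPlus]
  split_ifs <;> simp_all

theorem projPhiPlus_conjTranspose : projPhiPlusᴴ = projPhiPlus := by
  ext p q
  rw [Matrix.conjTranspose_apply, projPhiPlus_apply, projPhiPlus_apply]
  simp only [and_comm]
  split_ifs <;> simp

theorem projPhiPlus_mul_self : projPhiPlus * projPhiPlus = projPhiPlus := by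
  ext p q
  simp only [Matrix.mul_apply, projPhiPlus_apply, Fintype.sum_prod_type, Fintype.sum_bool]
  by_cases h1 : p.1 = p.2 <;> by_cases h2 : q.1 = q.2 <;> simp [h1, h2]
  norm_num

theorem Nbit_conjTranspose (a : Bool) : (Nbit a)ᴴ = Nbit a := by
  cases a <;> simp [Nbit, projPhiPlus_conjTranspose]

theorem Nbit_mul (a b : Bool) : Nbit a * Nbit b = if a = b then Nbit a else 0 := by
  cases a <;> cases b <;> simp [Nbit, mul_sub, sub_mul, projPhiPlus_mul_self]

/-- Grouping the qubit of `V` with the output qubit selected by `z`. -/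
def pairEquiv (z : Bool) : Bool × Bool × Bool ≃ (Bool × Bool) × Bool where
  toFun r := if z then ((r.1, r.2.2), r.2.1) else ((r.1, r.2.1), r.2.2)
  invFun r := if z then (r.1.1, r.2, r.1.2) else (r.1.1, r.1.2, r.2)
  left_inv r := by cases z <;> rfl
  right_inv r := by cases z <;> rfl

/-- The measurement operator on the `i`-th qubits of `V`, `A'` and `B'`. -/
def locMeas (z a : Bool) : Matrix (Bool × Bool × Bool) (Bool × Bool × Bool) ℂ :=
  (Nbit a ⊗ₖ (1 : Matrix Bool Bool ℂ)).submatrix (pairEquiv z) (pairEquiv z)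

theorem locMeas_conjTranspose (z a : Bool) : (locMeas z a)ᴴ = locMeas z a := by
  rw [locMeas, Matrix.conjTranspose_submatrix, Matrix.conjTranspose_kronecker, Nbit_conjTranspose,
    Matrix.conjTranspose_one]

theorem locMeas_mul (z a b : Bool) :
    locMeas z a * locMeas z b = if a = b then locMeas z a else 0 := by
  rw [locMeas, locMeas, Matrix.submatrix_mul_equiv, ← Matrix.mul_kronecker_mul, Nbit_mul, one_mul]
  split_ifs <;> simp

variable {m : ℕ} {EA EB : Type*}

/-- The joint response of the two provers. -/
def respond (K : Matrix (Bits m × EA) (Bits m × EA) ℂ) (L : Matrix (Bits m × EB) (Bits m × EB) ℂ) :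
    Matrix (Bits m × (Bits m × EA) × (Bits m × EB)) (Bits m × (Bits m × EA) × (Bits m × EB)) ℂ :=
  (1 : Matrix (Bits m) (Bits m) ℂ) ⊗ₖ (K ⊗ₖ L)

theorem star_respond (K : Matrix (Bits m × EA) (Bits m × EA) ℂ)
    (L : Matrix (Bits m × EB) (Bits m × EB) ℂ) : star (respond K L) = respond (star K) (star L) := by
  simp only [respond, Matrix.star_eq_conjTranspose, Matrix.conjTranspose_kronecker,
    Matrix.conjTranspose_one]

variable [DecidableEq EA] [DecidableEq EB]

/-- Regrouping the registers qubit by qubit. -/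
def qubitEquiv (m : ℕ) (EA EB : Type*) :
    Bits m × (Bits m × EA) × (Bits m × EB) ≃ (Fin m → Bool × Bool × Bool) × EA × EB where
  toFun r := (fun i => (r.1 i, r.2.1.1 i, r.2.2.1 i), r.2.1.2, r.2.2.2)
  invFun r := (fun i => (r.1 i).1, (fun i => (r.1 i).2.1, r.2.1), (fun i => (r.1 i).2.2, r.2.2))
  left_inv _ := rfl
  right_inv _ := rfl

/-- A tensor product of three-qubit operators, seen as an operator on `V ⊗ A' ⊗ B'`. -/
def lift3 (EA EB : Type*) [DecidableEq EA] [DecidableEq EB]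
    (X : Matrix (Fin m → Bool × Bool × Bool) (Fin m → Bool × Bool × Bool) ℂ) :
    Matrix (Bits m × (Bits m × EA) × (Bits m × EB)) (Bits m × (Bits m × EA) × (Bits m × EB)) ℂ :=
  (X ⊗ₖ (1 : Matrix (EA × EB) (EA × EB) ℂ)).submatrix (qubitEquiv m EA EB) (qubitEquiv m EA EB)

theorem lift3_mul [Fintype EA] [Fintype EB]
    (X Y : Matrix (Fin m → Bool × Bool × Bool) (Fin m → Bool × Bool × Bool) ℂ) :
    lift3 EA EB X * lift3 EA EB Y = lift3 EA EB (X * Y) := by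
  rw [lift3, lift3, Matrix.submatrix_mul_equiv, ← Matrix.mul_kronecker_mul, one_mul]; rfl

theorem Nmat_eq_lift3 (z a : Bits m) :
    (Nmat m z a : Matrix (Bits m × (Bits m × EA) × (Bits m × EB)) _ ℂ) =
      lift3 EA EB (tens fun i => locMeas (z i) (a i)) := by
  ext r c
  simp only [Nmat, lift3, Matrix.submatrix_apply, Matrix.kronecker_apply, tens, qubitEquiv,
    Equiv.coe_fn_mk, Matrix.one_apply, Prod.mk.injEq, ite_and]
  rw [mul_comm]
  congr 1
  · refine Finset.prod_congr rfl fun i _ => ?_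
    cases z i <;> simp [locMeas, pairEquiv, Matrix.one_apply]
  · split_ifs <;> simp

theorem Nmat_conjTranspose (z a : Bits m) :
    (Nmat m z a : Matrix (Bits m × (Bits m × EA) × (Bits m × EB)) _ ℂ)ᴴ = Nmat m z a := by
  rw [Nmat_eq_lift3, lift3, Matrix.conjTranspose_submatrix, Matrix.conjTranspose_kronecker,
    tens_conjTranspose, Matrix.conjTranspose_one]
  simp only [locMeas_conjTranspose]

variable [Fintype EA] [Fintype EB]

theorem Nmat_mul (z a b : Bits m) :
    (Nmat m z a : Matrix (Bits m × (Bits m × EA) × (Bits m × EB)) _ ℂ) * Nmat m z b =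
      if a = b then Nmat m z a else 0 := by
  rw [Nmat_eq_lift3, Nmat_eq_lift3, lift3_mul, tens_mul]
  simp only [locMeas_mul]
  split_ifs with h
  · simp [h]
  · obtain ⟨i, hi⟩ := Function.ne_iff.1 h
    rw [tens_eq_zero _ i (by simp [hi])]
    simp [lift3]

/-- Matrix units on the `i`-th qubit of `V`. -/
def unitV (EA EB : Type*) [DecidableEq EA] [DecidableEq EB] (i : Fin m) (s t : Bool) :
    Matrix (Bits m × (Bits m × EA) × (Bits m × EB)) (Bits m × (Bits m × EA) × (Bits m × EB)) ℂ :=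
  bitUnit i s t ⊗ₖ 1

/-- Matrix units on the `i`-th output qubit of `A'`, in the frame rotated by `K`. -/
def unitA (EB : Type*) [DecidableEq EB] (K : Matrix (Bits m × EA) (Bits m × EA) ℂ)
    (i : Fin m) (s t : Bool) :
    Matrix (Bits m × (Bits m × EA) × (Bits m × EB)) (Bits m × (Bits m × EA) × (Bits m × EB)) ℂ :=
  1 ⊗ₖ ((star K * (bitUnit i s t ⊗ₖ 1) * K) ⊗ₖ 1)

/-- Matrix units on the `i`-th output qubit of `B'`, in the frame rotated by `L`. -/
def unitB (EA : Type*) [DecidableEq EA] (L : Matrix (Bits m × EB) (Bits m × EB) ℂ)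
    (i : Fin m) (s t : Bool) :
    Matrix (Bits m × (Bits m × EA) × (Bits m × EB)) (Bits m × (Bits m × EA) × (Bits m × EB)) ℂ :=
  1 ⊗ₖ (1 ⊗ₖ (star L * (bitUnit i s t ⊗ₖ 1) * L))

variable {K : Matrix (Bits m × EA) (Bits m × EA) ℂ} {L : Matrix (Bits m × EB) (Bits m × EB) ℂ}

theorem isMatrixUnits_unitV (i : Fin m) : IsMatrixUnits (unitV EA EB i) :=
  (isMatrixUnits_bitUnit i).kronecker_one

theorem isMatrixUnits_unitA (hK : K ∈ Matrix.unitaryGroup (Bits m × EA) ℂ) (i : Fin m) :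
    IsMatrixUnits (unitA EB K i) :=
  (((isMatrixUnits_bitUnit i).kronecker_one.conj hK).kronecker_one).one_kronecker

theorem isMatrixUnits_unitB (hL : L ∈ Matrix.unitaryGroup (Bits m × EB) ℂ) (i : Fin m) :
    IsMatrixUnits (unitB EA L i) :=
  (((isMatrixUnits_bitUnit i).kronecker_one.conj hL).one_kronecker).one_kronecker

theorem commute_unitV_unitA (i j : Fin m) (s t u v : Bool) :
    Commute (unitV EA EB i s t) (unitA EB K j u v) :=
  commute_kronecker_one_one_kronecker _ _

theorem commute_unitV_unitB (i j : Fin m) (s t u v : Bool) :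
    Commute (unitV EA EB i s t) (unitB EA L j u v) :=
  commute_kronecker_one_one_kronecker _ _

theorem commute_unitA_unitB (i j : Fin m) (s t u v : Bool) :
    Commute (unitA EB K i s t) (unitB EA L j u v) := by
  simp only [commute_iff_eq, unitA, unitB, ← Matrix.mul_kronecker_mul, one_mul, mul_one]

theorem commute_unitV {i j : Fin m} (h : i ≠ j) (s t u v : Bool) :
    Commute (unitV EA EB i s t) (unitV EA EB j u v) := by
  rw [commute_iff_eq, unitV, unitV, ← Matrix.mul_kronecker_mul, ← Matrix.mul_kronecker_mul,
    bitUnit, bitUnit, (tens_mulSingle_commute h _ _).eq]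

theorem bitUnit_apply (i : Fin m) (s t : Bool) (r c : Bits m) :
    bitUnit i s t r c = (if r i = s ∧ c i = t then 1 else 0) *
      if ∀ j, j ≠ i → r j = c j then 1 else 0 := by
  rw [bitUnit, tens_mulSingle_apply, Matrix.single_apply]
  simp only [eq_comm]

theorem locMeas_apply_false (z v a b v' a' b' : Bool) :
    locMeas z false (v, a, b) (v', a', b') =
      (1 / 2) * ∑ s, ∑ t, (if v = s ∧ v' = t then 1 else 0) *
        if z then (if b = s ∧ b' = t then 1 else 0) * (if a = a' then 1 else 0)
        else (if a = s ∧ a' = t then 1 else 0) * (if b = b' then 1 else 0) := by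
  cases z <;> cases v <;> cases v' <;> cases a <;> cases a' <;>
    simp [locMeas, pairEquiv, Nbit, projPhiPlus_apply, Matrix.one_apply]

theorem unitV_mul_unitA_one_apply (i : Fin m) (s t : Bool)
    (r c : Bits m × (Bits m × EA) × (Bits m × EB)) :
    (unitV EA EB i s t * unitA EB (1 : Matrix (Bits m × EA) (Bits m × EA) ℂ) i s t) r c =
      bitUnit i s t r.1 c.1 * (bitUnit i s t r.2.1.1 c.2.1.1 *
        (if r.2.1.2 = c.2.1.2 then 1 else 0) * (if r.2.2 = c.2.2 then 1 else 0)) := by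
  rw [unitV, unitA, ← Matrix.mul_kronecker_mul, star_one, one_mul, one_mul, mul_one, mul_one]
  simp only [Matrix.kroneckerMap_apply, Matrix.one_apply]

theorem unitV_mul_unitB_one_apply (i : Fin m) (s t : Bool)
    (r c : Bits m × (Bits m × EA) × (Bits m × EB)) :
    (unitV EA EB i s t * unitB EA (1 : Matrix (Bits m × EB) (Bits m × EB) ℂ) i s t) r c =
      bitUnit i s t r.1 c.1 * ((if r.2.1 = c.2.1 then 1 else 0) *
        (bitUnit i s t r.2.2.1 c.2.2.1 * (if r.2.2.2 = c.2.2.2 then 1 else 0))) := by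
  rw [unitV, unitB, ← Matrix.mul_kronecker_mul, star_one, one_mul, one_mul, mul_one, mul_one]
  simp only [Matrix.kroneckerMap_apply, Matrix.one_apply]

theorem entProj_unitA_one (i : Fin m) :
    entProj (unitV EA EB i) (unitA EB (1 : Matrix (Bits m × EA) (Bits m × EA) ℂ) i) =
      lift3 EA EB (tens (Pi.mulSingle i (locMeas false false))) := by
  ext r c
  have hb : r.2.2 = c.2.2 ↔
      (r.2.2.1 i = c.2.2.1 i ∧ ∀ j, j ≠ i → r.2.2.1 j = c.2.2.1 j) ∧ r.2.2.2 = c.2.2.2 := by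
    rw [Prod.ext_iff, funext_iff]
    refine and_congr_left fun _ => ⟨fun h => ⟨h i, fun j _ => h j⟩, fun h j => ?_⟩
    by_cases hj : j = i
    · exact hj ▸ h.1
    · exact h.2 j hj
  have hall : (∀ j, j ≠ i → (r.1 j, r.2.1.1 j, r.2.2.1 j) = (c.1 j, c.2.1.1 j, c.2.2.1 j)) ↔
      (∀ j, j ≠ i → r.1 j = c.1 j) ∧ (∀ j, j ≠ i → r.2.1.1 j = c.2.1.1 j) ∧
        (∀ j, j ≠ i → r.2.2.1 j = c.2.2.1 j) := by
    simp only [Prod.mk.injEq, imp_and, forall_and]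
  have hE : (r.2.1.2, r.2.2.2) = (c.2.1.2, c.2.2.2) ↔ r.2.1.2 = c.2.1.2 ∧ r.2.2.2 = c.2.2.2 :=
    Prod.mk_inj
  rw [entProj, Matrix.smul_apply, lift3, Matrix.submatrix_apply, Matrix.kronecker_apply,
    tens_mulSingle_apply, Matrix.one_apply]
  simp only [Matrix.sum_apply, unitV_mul_unitA_one_apply, bitUnit_apply, qubitEquiv,
    Equiv.coe_fn_mk, locMeas_apply_false, hall, hb, hE, smul_eq_mul, mul_assoc]
  simp only [ite_and, Bool.false_eq_true, if_false]
  congr 1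
  simp only [Finset.sum_mul]
  refine Finset.sum_congr rfl fun s _ => Finset.sum_congr rfl fun t _ => ?_
  split_ifs <;> simp

theorem entProj_unitB_one (i : Fin m) :
    entProj (unitV EA EB i) (unitB EA (1 : Matrix (Bits m × EB) (Bits m × EB) ℂ) i) =
      lift3 EA EB (tens (Pi.mulSingle i (locMeas true false))) := by
  ext r c
  have hb : r.2.1 = c.2.1 ↔
      (r.2.1.1 i = c.2.1.1 i ∧ ∀ j, j ≠ i → r.2.1.1 j = c.2.1.1 j) ∧ r.2.1.2 = c.2.1.2 := by
    rw [Prod.ext_iff, funext_iff]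
    refine and_congr_left fun _ => ⟨fun h => ⟨h i, fun j _ => h j⟩, fun h j => ?_⟩
    by_cases hj : j = i
    · exact hj ▸ h.1
    · exact h.2 j hj
  have hall : (∀ j, j ≠ i → (r.1 j, r.2.1.1 j, r.2.2.1 j) = (c.1 j, c.2.1.1 j, c.2.2.1 j)) ↔
      (∀ j, j ≠ i → r.1 j = c.1 j) ∧ (∀ j, j ≠ i → r.2.1.1 j = c.2.1.1 j) ∧
        (∀ j, j ≠ i → r.2.2.1 j = c.2.2.1 j) := by
    simp only [Prod.mk.injEq, imp_and, forall_and]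
  have hE : (r.2.1.2, r.2.2.2) = (c.2.1.2, c.2.2.2) ↔ r.2.1.2 = c.2.1.2 ∧ r.2.2.2 = c.2.2.2 :=
    Prod.mk_inj
  rw [entProj, Matrix.smul_apply, lift3, Matrix.submatrix_apply, Matrix.kronecker_apply,
    tens_mulSingle_apply, Matrix.one_apply]
  simp only [Matrix.sum_apply, unitV_mul_unitB_one_apply, bitUnit_apply, qubitEquiv,
    Equiv.coe_fn_mk, locMeas_apply_false, hall, hb, hE, smul_eq_mul, mul_assoc]
  simp only [ite_and, if_true]
  congr 1
  simp only [Finset.sum_mul]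
  refine Finset.sum_congr rfl fun s _ => Finset.sum_congr rfl fun t _ => ?_
  split_ifs <;> simp

theorem lift3_mulSingle_mul_Nmat (z a : Bits m) (i : Fin m) (ha : a i = false) :
    lift3 EA EB (tens (Pi.mulSingle i (locMeas (z i) false))) * Nmat m z a = Nmat m z a := by
  rw [Nmat_eq_lift3, lift3_mul, tens_mul]
  congr 2
  ext1 j
  by_cases h : j = i
  · subst h
    rw [Pi.mulSingle_eq_same, ha, locMeas_mul, if_pos rfl]
  · rw [Pi.mulSingle_eq_of_ne h, one_mul]

theorem respond_mem_unitary (hK : K ∈ Matrix.unitaryGroup (Bits m × EA) ℂ)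
    (hL : L ∈ Matrix.unitaryGroup (Bits m × EB) ℂ) :
    respond K L ∈ Matrix.unitaryGroup (Bits m × (Bits m × EA) × (Bits m × EB)) ℂ := by
  rw [Matrix.mem_unitaryGroup_iff, star_respond, respond, respond, ← Matrix.mul_kronecker_mul,
    ← Matrix.mul_kronecker_mul, Matrix.mem_unitaryGroup_iff.1 hK, Matrix.mem_unitaryGroup_iff.1 hL]
  simp

theorem conj_respond_unitA (hL : L ∈ Matrix.unitaryGroup (Bits m × EB) ℂ) (i : Fin m) :
    entProj (unitV EA EB i) (unitA EB K i) =
      star (respond K L) * entProj (unitV EA EB i) (unitA EB 1 i) * respond K L := by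
  have h : ∀ s t, unitV EA EB i s t * unitA EB K i s t =
      star (respond K L) * (unitV EA EB i s t * unitA EB 1 i s t) * respond K L := fun s t => by
    rw [star_respond, unitV, unitA, unitA, respond, respond]
    simp only [← Matrix.mul_kronecker_mul, one_mul, mul_one, star_one,
      Matrix.mem_unitaryGroup_iff'.1 hL]
  simp only [entProj, h, Matrix.mul_smul, Matrix.smul_mul, Finset.mul_sum, Finset.sum_mul]

theorem conj_respond_unitB (hK : K ∈ Matrix.unitaryGroup (Bits m × EA) ℂ) (i : Fin m) :
    entProj (unitV EA EB i) (unitB EA L i) =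
      star (respond K L) * entProj (unitV EA EB i) (unitB EA 1 i) * respond K L := by
  have h : ∀ s t, unitV EA EB i s t * unitB EA L i s t =
      star (respond K L) * (unitV EA EB i s t * unitB EA 1 i s t) * respond K L := fun s t => by
    rw [star_respond, unitV, unitB, unitB, respond, respond]
    simp only [← Matrix.mul_kronecker_mul, one_mul, mul_one, star_one,
      Matrix.mem_unitaryGroup_iff'.1 hK]
  simp only [entProj, h, Matrix.mul_smul, Matrix.smul_mul, Finset.mul_sum, Finset.sum_mul]

/-- The measurement operator `N^z_a` pulled back through the provers' response. -/
def pulledN (K : Matrix (Bits m × EA) (Bits m × EA) ℂ) (L : Matrix (Bits m × EB) (Bits m × EB) ℂ)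
    (z a : Bits m) :
    Matrix (Bits m × (Bits m × EA) × (Bits m × EB)) (Bits m × (Bits m × EA) × (Bits m × EB)) ℂ :=
  star (respond K L) * Nmat m z a * respond K L

theorem isSelfAdjoint_pulledN (z a : Bits m) : IsSelfAdjoint (pulledN K L z a) := by
  rw [IsSelfAdjoint, pulledN, star_mul, star_mul, star_star, Matrix.star_eq_conjTranspose (Nmat _ _ _),
    Nmat_conjTranspose, mul_assoc]

theorem pulledN_mul_self (hK : K ∈ Matrix.unitaryGroup (Bits m × EA) ℂ)
    (hL : L ∈ Matrix.unitaryGroup (Bits m × EB) ℂ) (z a : Bits m) :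
    pulledN K L z a * pulledN K L z a = pulledN K L z a := by
  have : pulledN K L z a * pulledN K L z a =
      star (respond K L) * (Nmat m z a * ((respond K L * star (respond K L)) * Nmat m z a)) *
        respond K L := by
    simp only [pulledN, mul_assoc]
  rw [this, Matrix.mem_unitaryGroup_iff.1 (respond_mem_unitary hK hL), one_mul, Nmat_mul,
    if_pos rfl, pulledN]

theorem entProj_unitA_mul_pulledN (hK : K ∈ Matrix.unitaryGroup (Bits m × EA) ℂ)
    (hL : L ∈ Matrix.unitaryGroup (Bits m × EB) ℂ) (z a : Bits m) (i : Fin m)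
    (hz : z i = false) (ha : a i = false) :
    entProj (unitV EA EB i) (unitA EB K i) * pulledN K L z a = pulledN K L z a := by
  have h := lift3_mulSingle_mul_Nmat (EA := EA) (EB := EB) z a i ha
  rw [hz, ← entProj_unitA_one] at h
  have h2 : ∀ T W : Matrix (Bits m × (Bits m × EA) × (Bits m × EB)) _ ℂ,
      star W * T * W * (star W * Nmat m z a * W) =
        star W * (T * ((W * star W) * Nmat m z a)) * W := fun T W => by simp only [mul_assoc]
  rw [conj_respond_unitA hL, pulledN, h2,
    Matrix.mem_unitaryGroup_iff.1 (respond_mem_unitary hK hL), one_mul, h]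

theorem entProj_unitB_mul_pulledN (hK : K ∈ Matrix.unitaryGroup (Bits m × EA) ℂ)
    (hL : L ∈ Matrix.unitaryGroup (Bits m × EB) ℂ) (z a : Bits m) (i : Fin m)
    (hz : z i = true) (ha : a i = false) :
    entProj (unitV EA EB i) (unitB EA L i) * pulledN K L z a = pulledN K L z a := by
  have h := lift3_mulSingle_mul_Nmat (EA := EA) (EB := EB) z a i ha
  rw [hz, ← entProj_unitB_one] at h
  have h2 : ∀ T W : Matrix (Bits m × (Bits m × EA) × (Bits m × EB)) _ ℂ,
      star W * T * W * (star W * Nmat m z a * W) =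
        star W * (T * ((W * star W) * Nmat m z a)) * W := fun T W => by simp only [mul_assoc]
  rw [conj_respond_unitB hK, pulledN, h2,
    Matrix.mem_unitaryGroup_iff.1 (respond_mem_unitary hK hL), one_mul, h]

end Measurement

section Overlap

variable {m : ℕ} {EA EB : Type*} [DecidableEq EA] [DecidableEq EB] [Fintype EA] [Fintype EB]

theorem norm_inner_le_of_entProj_fixed {K : Matrix (Bits m × EA) (Bits m × EA) ℂ}
    {L : Matrix (Bits m × EB) (Bits m × EB) ℂ} (hK : K ∈ Matrix.unitaryGroup (Bits m × EA) ℂ)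
    (hL : L ∈ Matrix.unitaryGroup (Bits m × EB) ℂ) (D : Finset (Fin m))
    (u v : EuclideanSpace ℂ (Bits m × (Bits m × EA) × (Bits m × EB)))
    (hu : ∀ i ∈ D, Matrix.toEuclideanCLM (𝕜 := ℂ) (entProj (unitV EA EB i) (unitA EB K i)) u = u)
    (hv : ∀ i ∈ D, Matrix.toEuclideanCLM (𝕜 := ℂ) (entProj (unitV EA EB i) (unitB EA L i)) v = v) :
    ‖(inner ℂ u v : ℂ)‖ ≤ (1 / 2) ^ D.card * (‖u‖ * ‖v‖) := by
  refine norm_inner_le_of_unbiased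
    (fun i => Matrix.toEuclideanCLM (𝕜 := ℂ) (entProj (unitV EA EB i) (unitA EB K i)))
    (fun i => Matrix.toEuclideanCLM (𝕜 := ℂ) (entProj (unitV EA EB i) (unitB EA L i)))
    (fun i => ?_) (fun i => ?_) (fun i => ?_) (fun i => ?_) (fun i j hij => ?_) D u v hu hv
  · exact (isSelfAdjoint_entProj (isMatrixUnits_unitV i) (isMatrixUnits_unitA hK i)
      (commute_unitV_unitA i i)).map _
  · exact (isSelfAdjoint_entProj (isMatrixUnits_unitV i) (isMatrixUnits_unitB hL i)
      (commute_unitV_unitB i i)).map _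
  · rw [← map_mul, entProj_mul_self (isMatrixUnits_unitV i) (isMatrixUnits_unitB hL i)
      (commute_unitV_unitB i i)]
  · rw [← map_mul, ← map_mul, entProj_unbiased (isMatrixUnits_unitV i) (isMatrixUnits_unitA hK i)
      (isMatrixUnits_unitB hL i) (commute_unitV_unitA i i) (commute_unitV_unitB i i)
      (commute_unitA_unitB i i), map_smul]
  · exact (commute_entProj (commute_unitV hij) (commute_unitV_unitB i j)
      (commute_unitV_unitA j i) (commute_unitA_unitB i j)).map _

theorem toEuclideanCLM_apply_of_mul {I : Type*} [Fintype I] [DecidableEq I] {M N : Matrix I I ℂ}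
    (h : M * N = N) {u : EuclideanSpace ℂ I} (hu : Matrix.toEuclideanCLM (𝕜 := ℂ) N u = u) :
    Matrix.toEuclideanCLM (𝕜 := ℂ) M u = u := by
  conv_lhs => rw [← hu]
  rw [← mul_apply_eq_comp, ← map_mul, h, hu]

/-- The bound on the overlap of the ranges of `N^z_a` and `N^{z'}_a`. -/
def overlapBound (a z z' : Bits m) : ℝ :=
  ∏ i, if a i = false ∧ z i ≠ z' i then 1 / Real.sqrt 2 else 1

theorem overlapBound_comm (a z z' : Bits m) : overlapBound a z z' = overlapBound a z' z := by
  simp only [overlapBound, ne_comm]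

theorem overlapBound_nonneg (a z z' : Bits m) : 0 ≤ overlapBound a z z' :=
  Finset.prod_nonneg fun i _ => by split_ifs <;> positivity

theorem sum_overlapBound (a z : Bits m) :
    ∑ z', overlapBound a z z' = 2 ^ m * (1 / 2 + 1 / (2 * Real.sqrt 2)) ^ (m - hw a) := by
  have h1 : ∑ z', overlapBound a z z' =
      ∏ i, ∑ b : Bool, if a i = false ∧ z i ≠ b then 1 / Real.sqrt 2 else 1 := by
    rw [Finset.prod_univ_sum, Fintype.piFinset_univ]; rfl
  have h2 : ∀ i, (∑ b : Bool, if a i = false ∧ z i ≠ b then 1 / Real.sqrt 2 else 1) =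
      2 * if a i = false then 1 / 2 + 1 / (2 * Real.sqrt 2) else 1 := fun i => by
    cases z i <;> cases a i <;> simp <;> ring
  rw [h1, Finset.prod_congr rfl fun i _ => h2 i, Finset.prod_mul_distrib, Finset.prod_const,
    Finset.card_univ, Fintype.card_fin, Finset.prod_ite, Finset.prod_const, Finset.prod_const_one,
    mul_one]
  congr 2
  have := Finset.card_filter_add_card_filter_not (s := (Finset.univ : Finset (Fin m)))
    (fun i => a i = true)
  rw [Finset.card_univ, Fintype.card_fin] at this
  simp only [Bool.not_eq_true] at this
  rw [hw]
  omega

theorem norm_inner_le_overlapBound {K K' : Matrix (Bits m × EA) (Bits m × EA) ℂ}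
    {L L' : Matrix (Bits m × EB) (Bits m × EB) ℂ} (hK : K ∈ Matrix.unitaryGroup (Bits m × EA) ℂ)
    (hL : L ∈ Matrix.unitaryGroup (Bits m × EB) ℂ)
    (hK' : K' ∈ Matrix.unitaryGroup (Bits m × EA) ℂ)
    (hL' : L' ∈ Matrix.unitaryGroup (Bits m × EB) ℂ) (a z z' : Bits m)
    (u v : EuclideanSpace ℂ (Bits m × (Bits m × EA) × (Bits m × EB)))
    (hu : Matrix.toEuclideanCLM (𝕜 := ℂ) (pulledN K L z a) u = u)
    (hv : Matrix.toEuclideanCLM (𝕜 := ℂ) (pulledN K' L' z' a) v = v) :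
    ‖(inner ℂ u v : ℂ)‖ ≤ overlapBound a z z' * (‖u‖ * ‖v‖) := by
  set D₁ := Finset.univ.filter fun i => a i = false ∧ z i = false ∧ z' i = true with hD₁
  set D₂ := Finset.univ.filter fun i => a i = false ∧ z i = true ∧ z' i = false with hD₂
  have h1 : ‖(inner ℂ u v : ℂ)‖ ≤ (1 / 2) ^ D₁.card * (‖u‖ * ‖v‖) := by
    refine norm_inner_le_of_entProj_fixed hK hL' D₁ u v (fun i hi => ?_) (fun i hi => ?_)
    all_goals
      rw [hD₁, Finset.mem_filter] at hi
      obtain ⟨-, ha, hz, hz'⟩ := hi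
    · exact toEuclideanCLM_apply_of_mul (entProj_unitA_mul_pulledN hK hL z a i hz ha) hu
    · exact toEuclideanCLM_apply_of_mul (entProj_unitB_mul_pulledN hK' hL' z' a i hz' ha) hv
  have h2 : ‖(inner ℂ u v : ℂ)‖ ≤ (1 / 2) ^ D₂.card * (‖u‖ * ‖v‖) := by
    rw [← inner_conj_symm, RCLike.norm_conj, mul_comm ‖u‖]
    refine norm_inner_le_of_entProj_fixed hK' hL D₂ v u (fun i hi => ?_) (fun i hi => ?_)
    all_goals
      rw [hD₂, Finset.mem_filter] at hi
      obtain ⟨-, ha, hz, hz'⟩ := hi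
    · exact toEuclideanCLM_apply_of_mul (entProj_unitA_mul_pulledN hK' hL' z' a i hz' ha) hv
    · exact toEuclideanCLM_apply_of_mul (entProj_unitB_mul_pulledN hK hL z a i hz ha) hu
  have h3 : overlapBound a z z' = (1 / Real.sqrt 2) ^ (D₁.card + D₂.card) := by
    rw [overlapBound, Finset.prod_ite, Finset.prod_const, Finset.prod_const_one, mul_one,
      ← Finset.card_union_of_disjoint]
    · congr 2
      ext i
      simp only [hD₁, hD₂, Finset.mem_filter, Finset.mem_union, Finset.mem_univ, true_and]
      cases z i <;> cases z' i <;> simp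
    · rw [Finset.disjoint_left]
      intro i hi hi'
      simp only [hD₁, hD₂, Finset.mem_filter] at hi hi'
      simp [hi.2.2.1] at hi'
  have h4 : (1 / Real.sqrt 2) ^ 2 = (1 / 2 : ℝ) := by
    rw [div_pow, Real.sq_sqrt (by norm_num), one_pow]
  have h0 : (0 : ℝ) ≤ 1 / Real.sqrt 2 := by positivity
  have h5 : (1 / Real.sqrt 2 : ℝ) ≤ 1 := by
    rw [div_le_one (by positivity)]; exact Real.one_le_sqrt.2 (by norm_num)
  rw [h3]
  rcases le_total D₁.card D₂.card with h | h
  · refine h2.trans (mul_le_mul_of_nonneg_right ?_ (by positivity))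
    rw [← h4, ← pow_mul]
    exact pow_le_pow_of_le_one h0 h5 (by omega)
  · refine h1.trans (mul_le_mul_of_nonneg_right ?_ (by positivity))
    rw [← h4, ← pow_mul]
    exact pow_le_pow_of_le_one h0 h5 (by omega)

theorem sum_norm_sq_pulledN_le (K : Bits m → Matrix (Bits m × EA) (Bits m × EA) ℂ)
    (L : Bits m → Matrix (Bits m × EB) (Bits m × EB) ℂ)
    (hK : ∀ z, K z ∈ Matrix.unitaryGroup (Bits m × EA) ℂ)
    (hL : ∀ z, L z ∈ Matrix.unitaryGroup (Bits m × EB) ℂ) (a : Bits m)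
    (ψ : EuclideanSpace ℂ (Bits m × (Bits m × EA) × (Bits m × EB))) (hψ : ‖ψ‖ ≤ 1) :
    ∑ z, ‖Matrix.toEuclideanCLM (𝕜 := ℂ) (pulledN (K z) (L z) z a) ψ‖ ^ 2 ≤
      2 ^ m * (1 / 2 + 1 / (2 * Real.sqrt 2)) ^ (m - hw a) :=
  sum_norm_sq_le_of_overlap
    (fun z => Matrix.toEuclideanCLM (𝕜 := ℂ) (pulledN (K z) (L z) z a))
    (fun z => (isSelfAdjoint_pulledN z a).map _)
    (fun z => by rw [← map_mul, pulledN_mul_self (hK z) (hL z)])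
    (overlapBound a) (overlapBound_comm a) (overlapBound_nonneg a)
    (fun z z' u v hu hv =>
      norm_inner_le_overlapBound (hK z) (hL z) (hK z') (hL z') a z z' u v hu hv)
    _ (fun z => (sum_overlapBound a z).le) (by positivity) ψ hψ

end Overlap

section Weights

theorem sum_bits_prod {m : ℕ} (g : Bool → ℝ) :
    ∑ a : Bits m, ∏ i, g (a i) = (g true + g false) ^ m := by
  have : (g true + g false) ^ m = ∏ _i : Fin m, ∑ b : Bool, g b := by simp
  rw [this, Finset.prod_univ_sum, Fintype.piFinset_univ]

theorem pow_hw {m : ℕ} (x : ℝ) (a : Bits m) :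
    x ^ hw a = ∏ i, if a i then x else 1 := by
  rw [Finset.prod_ite, Finset.prod_const, Finset.prod_const_one, mul_one, hw]

theorem card_hw_le (γ : ℝ) (hγ0 : 0 ≤ γ) (hγ1 : γ < 1 / 2) (m : ℕ) :
    ((Finset.univ.filter fun a : Bits m => (hw a : ℝ) ≤ γ * m).card : ℝ) ≤
      ((2 : ℝ) ^ binEnt γ) ^ m := by
  rcases hγ0.eq_or_lt with rfl | hγ
  · have : (Finset.univ.filter fun a : Bits m => (hw a : ℝ) ≤ 0 * m) ⊆ {fun _ => false} := by
      intro a ha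
      simp only [zero_mul, Finset.mem_filter, Finset.mem_univ, true_and] at ha
      have h0 : hw a = 0 := by exact_mod_cast le_antisymm ha (by positivity)
      rw [hw, Finset.card_eq_zero, Finset.filter_eq_empty_iff] at h0
      rw [Finset.mem_singleton]
      funext i
      simpa using h0 (Finset.mem_univ i)
    have h := Finset.card_le_card this
    rw [Finset.card_singleton] at h
    have : binEnt 0 = 0 := by simp [binEnt]
    rw [this, Real.rpow_zero, one_pow]
    exact_mod_cast h
  · have h1γ : 0 < 1 - γ := by linarith
    set β := γ / (1 - γ) with hβ
    have hβ0 : 0 < β := by positivity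
    have hβ1 : β ≤ 1 := by rw [hβ, div_le_one h1γ]; linarith
    have hent : (2 : ℝ) ^ binEnt γ = (1 + β) * β ^ (-γ) := by
      have e1 : 1 + β = (1 - γ)⁻¹ := by rw [hβ]; field_simp; ring
      apply Real.log_injOn_pos (Set.mem_Ioi.2 (by positivity)) (Set.mem_Ioi.2 (by positivity))
      rw [Real.log_mul (by positivity) (by positivity), Real.log_rpow (by norm_num),
        Real.log_rpow hβ0, e1, Real.log_inv, hβ, Real.log_div hγ.ne' h1γ.ne', binEnt, Real.logb,
        Real.logb]
      have : Real.log 2 ≠ 0 := (Real.log_pos (by norm_num)).ne'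
      field_simp
      ring
    have hsum : ∑ a : Bits m, β ^ hw a = (1 + β) ^ m := by
      simp only [pow_hw]
      rw [sum_bits_prod fun b => if b then β else 1]
      simp [add_comm]
    calc ((Finset.univ.filter fun a : Bits m => (hw a : ℝ) ≤ γ * m).card : ℝ)
        = ∑ a ∈ Finset.univ.filter (fun a : Bits m => (hw a : ℝ) ≤ γ * m), 1 := by simp
      _ ≤ ∑ a ∈ Finset.univ.filter (fun a : Bits m => (hw a : ℝ) ≤ γ * m),
            β ^ hw a * (β ^ (-γ)) ^ m := by
          refine Finset.sum_le_sum fun a ha => ?_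
          rw [Finset.mem_filter] at ha
          rw [← Real.rpow_natCast β, ← Real.rpow_mul_natCast hβ0.le, ← Real.rpow_add hβ0]
          exact Real.one_le_rpow_of_pos_of_le_one_of_nonpos hβ0 hβ1 (by linarith [ha.2])
      _ ≤ ∑ a : Bits m, β ^ hw a * (β ^ (-γ)) ^ m :=
          Finset.sum_le_sum_of_subset_of_nonneg (Finset.filter_subset _ _)
            fun _ _ _ => by positivity
      _ = ((2 : ℝ) ^ binEnt γ) ^ m := by rw [← Finset.sum_mul, hsum, hent, mul_pow]

theorem sum_pow_hw_le (γ : ℝ) (hγ0 : 0 ≤ γ) (hγ1 : γ < 1 / 2) (m : ℕ) :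
    ∑ a ∈ Finset.univ.filter (fun a : Bits m => (hw a : ℝ) ≤ γ * m),
      (1 / 2 + 1 / (2 * Real.sqrt 2)) ^ (m - hw a) ≤ muGamma γ ^ m := by
  set μ₀ : ℝ := 1 / 2 + 1 / (2 * Real.sqrt 2) with hμ₀
  have hμ : (1 / 2 : ℝ) ≤ μ₀ := by rw [hμ₀]; linarith [show 0 ≤ 1 / (2 * Real.sqrt 2) by positivity]
  have hterm : ∀ a ∈ Finset.univ.filter (fun a : Bits m => (hw a : ℝ) ≤ γ * m),
      μ₀ ^ (m - hw a) ≤ μ₀ ^ m * ((2 : ℝ) ^ γ) ^ m := fun a ha => by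
    rw [Finset.mem_filter] at ha
    have hle : hw a ≤ m := by
      have := Finset.card_filter_le (Finset.univ : Finset (Fin m)) fun i => a i = true
      rwa [Finset.card_univ, Fintype.card_fin] at this
    have h1 : (1 : ℝ) ≤ μ₀ ^ hw a * 2 ^ hw a := by
      rw [← mul_pow]; exact one_le_pow₀ (by linarith)
    have h2 : (2 : ℝ) ^ hw a ≤ ((2 : ℝ) ^ γ) ^ m := by
      rw [← Real.rpow_mul_natCast (by norm_num), ← Real.rpow_natCast]
      exact Real.rpow_le_rpow_of_exponent_le (by norm_num) ha.2
    calc μ₀ ^ (m - hw a) ≤ μ₀ ^ (m - hw a) * (μ₀ ^ hw a * 2 ^ hw a) :=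
          le_mul_of_one_le_right (by positivity) h1
      _ = μ₀ ^ m * 2 ^ hw a := by rw [← mul_assoc, ← pow_add, Nat.sub_add_cancel hle]
      _ ≤ _ := mul_le_mul_of_nonneg_left h2 (by positivity)
  refine (Finset.sum_le_sum hterm).trans ?_
  rw [Finset.sum_const, nsmul_eq_mul]
  refine (mul_le_mul_of_nonneg_right (card_hw_le γ hγ0 hγ1 m) (by positivity)).trans_eq ?_
  rw [muGamma, ← mul_pow, ← mul_pow, Real.rpow_add (by norm_num)]
  ring

end Weights

section Acceptance

variable {m : ℕ} {EA EB : Type*} [DecidableEq EA] [DecidableEq EB] [Fintype EA] [Fintype EB]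

/-- The answers accepted with error tolerance `γ`. -/
def accepted (γ : ℝ) (m : ℕ) : Finset (Bits m) :=
  Finset.univ.filter fun a : Bits m => (hw a : ℝ) ≤ γ * m

/-- The probability that challenge `z` is answered acceptably from the state `ψ` by the
response `K ⊗ L`. -/
def acceptProb (γ : ℝ) (z : Bits m) (K : Matrix (Bits m × EA) (Bits m × EA) ℂ)
    (L : Matrix (Bits m × EB) (Bits m × EB) ℂ)
    (ψ : EuclideanSpace ℂ (Bits m × (Bits m × EA) × (Bits m × EB))) : ℝ :=
  ∑ a ∈ accepted γ m, ‖Matrix.toEuclideanCLM (𝕜 := ℂ) (pulledN K L z a) ψ‖ ^ 2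

variable {K : Matrix (Bits m × EA) (Bits m × EA) ℂ} {L : Matrix (Bits m × EB) (Bits m × EB) ℂ}

theorem pulledN_mul (hK : K ∈ Matrix.unitaryGroup (Bits m × EA) ℂ)
    (hL : L ∈ Matrix.unitaryGroup (Bits m × EB) ℂ) (z a b : Bits m) :
    pulledN K L z a * pulledN K L z b = if a = b then pulledN K L z a else 0 := by
  have : pulledN K L z a * pulledN K L z b =
      star (respond K L) * (Nmat m z a * ((respond K L * star (respond K L)) * Nmat m z b)) *
        respond K L := by
    simp only [pulledN, mul_assoc]
  rw [this, Matrix.mem_unitaryGroup_iff.1 (respond_mem_unitary hK hL), one_mul, Nmat_mul]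
  split_ifs <;> simp [pulledN]

theorem exists_projection_acceptProb (γ : ℝ) (z : Bits m)
    (hK : K ∈ Matrix.unitaryGroup (Bits m × EA) ℂ) (hL : L ∈ Matrix.unitaryGroup (Bits m × EB) ℂ) :
    ∃ Q : EuclideanSpace ℂ (Bits m × (Bits m × EA) × (Bits m × EB)) →L[ℂ]
        EuclideanSpace ℂ (Bits m × (Bits m × EA) × (Bits m × EB)),
      (∀ ψ, ‖Q ψ‖ ≤ ‖ψ‖) ∧ ∀ ψ, acceptProb γ z K L ψ = ‖Q ψ‖ ^ 2 := by
  set P := fun a => Matrix.toEuclideanCLM (𝕜 := ℂ) (pulledN K L z a) with hP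
  have hPs : ∀ a, IsSelfAdjoint (P a) := fun a => (isSelfAdjoint_pulledN z a).map _
  have hPm : ∀ a b, P a * P b = if a = b then P a else 0 := fun a b => by
    rw [hP, ← map_mul, pulledN_mul hK hL]
    split_ifs <;> simp
  set Q := ∑ a ∈ accepted γ m, P a with hQ
  have hQs : IsSelfAdjoint Q := by
    have h : IsSelfAdjoint (∑ a ∈ accepted γ m, pulledN K L z a) := by
      rw [IsSelfAdjoint, star_sum]
      exact Finset.sum_congr rfl fun a _ => isSelfAdjoint_pulledN z a
    rw [hQ, ← map_sum]
    exact h.map _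
  have hQQ : Q * Q = Q := by
    rw [hQ, Finset.sum_mul_sum]
    refine Finset.sum_congr rfl fun a ha => ?_
    simp [hPm, ha]
  refine ⟨Q, fun ψ => ?_, fun ψ => ?_⟩
  · by_contra hlt
    push Not at hlt
    have h1 : ‖Q ψ‖ ^ 2 ≤ ‖ψ‖ * ‖Q ψ‖ := by
      have := norm_inner_le_norm (𝕜 := ℂ) ψ (Q ψ)
      rwa [norm_sq_apply_of_isProj hQs hQQ, Complex.norm_real, Real.norm_of_nonneg (by positivity)]
        at this
    nlinarith [norm_nonneg ψ, norm_nonneg (Q ψ)]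
  · have h : ((acceptProb γ z K L ψ : ℝ) : ℂ) = ((‖Q ψ‖ ^ 2 : ℝ) : ℂ) := by
      rw [← norm_sq_apply_of_isProj hQs hQQ, hQ, _root_.sum_apply, inner_sum,
        acceptProb, Complex.ofReal_sum]
      exact Finset.sum_congr rfl fun a _ =>
        (norm_sq_apply_of_isProj (hPs a) (by rw [hPm, if_pos rfl]) ψ).symm
    exact_mod_cast h

theorem acceptProb_nonneg (γ : ℝ) (z : Bits m)
    (ψ : EuclideanSpace ℂ (Bits m × (Bits m × EA) × (Bits m × EB))) :
    0 ≤ acceptProb γ z K L ψ :=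
  Finset.sum_nonneg fun _ _ => by positivity

theorem acceptProb_le_one (γ : ℝ) (z : Bits m)
    (hK : K ∈ Matrix.unitaryGroup (Bits m × EA) ℂ) (hL : L ∈ Matrix.unitaryGroup (Bits m × EB) ℂ)
    {ψ : EuclideanSpace ℂ (Bits m × (Bits m × EA) × (Bits m × EB))} (hψ : ‖ψ‖ ≤ 1) :
    acceptProb γ z K L ψ ≤ 1 := by
  obtain ⟨Q, hQ1, hQ2⟩ := exists_projection_acceptProb γ z hK hL
  rw [hQ2]
  exact pow_le_one₀ (norm_nonneg _) ((hQ1 ψ).trans hψ)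

theorem acceptProb_le_add (γ : ℝ) (z : Bits m)
    (hK : K ∈ Matrix.unitaryGroup (Bits m × EA) ℂ) (hL : L ∈ Matrix.unitaryGroup (Bits m × EB) ℂ)
    {ψ ψ' : EuclideanSpace ℂ (Bits m × (Bits m × EA) × (Bits m × EB))} (hψ : ‖ψ‖ ≤ 1)
    (hψ' : ‖ψ'‖ ≤ 1) :
    acceptProb γ z K L ψ ≤ acceptProb γ z K L ψ' + 2 * ‖ψ - ψ'‖ := by
  obtain ⟨Q, hQ1, hQ2⟩ := exists_projection_acceptProb γ z hK hL
  rw [hQ2, hQ2]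
  have h1 : ‖Q ψ‖ - ‖Q ψ'‖ ≤ ‖ψ - ψ'‖ :=
    (norm_sub_norm_le _ _).trans (by rw [← map_sub]; exact hQ1 _)
  nlinarith [norm_nonneg (Q ψ), norm_nonneg (Q ψ'), (hQ1 ψ).trans hψ, (hQ1 ψ').trans hψ',
    norm_nonneg (ψ - ψ')]

/-- The best acceptance probability for challenge `z` from the state `ψ`. -/
def bestProb (γ : ℝ) (z : Bits m)
    (ψ : EuclideanSpace ℂ (Bits m × (Bits m × EA) × (Bits m × EB))) : ℝ :=
  ⨆ W : Matrix.unitaryGroup (Bits m × EA) ℂ × Matrix.unitaryGroup (Bits m × EB) ℂ,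
    acceptProb γ z W.1.1 W.2.1 ψ

variable {ψ ψ' : EuclideanSpace ℂ (Bits m × (Bits m × EA) × (Bits m × EB))}

theorem acceptProb_le_bestProb (γ : ℝ) (z : Bits m)
    (hK : K ∈ Matrix.unitaryGroup (Bits m × EA) ℂ) (hL : L ∈ Matrix.unitaryGroup (Bits m × EB) ℂ)
    (hψ : ‖ψ‖ ≤ 1) : acceptProb γ z K L ψ ≤ bestProb γ z ψ :=
  le_ciSup (f := fun W : Matrix.unitaryGroup (Bits m × EA) ℂ × Matrix.unitaryGroup (Bits m × EB) ℂ =>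
    acceptProb γ z W.1.1 W.2.1 ψ)
    ⟨1, by rintro _ ⟨W, rfl⟩; exact acceptProb_le_one γ z W.1.2 W.2.2 hψ⟩ (⟨K, hK⟩, ⟨L, hL⟩)

theorem bestProb_nonneg (γ : ℝ) (z : Bits m) : 0 ≤ bestProb γ z ψ :=
  Real.iSup_nonneg fun _ => acceptProb_nonneg γ z ψ

theorem bestProb_le_one (γ : ℝ) (z : Bits m) (hψ : ‖ψ‖ ≤ 1) : bestProb γ z ψ ≤ 1 :=
  ciSup_le fun W => acceptProb_le_one γ z W.1.2 W.2.2 hψ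

theorem bestProb_le_add (γ : ℝ) (z : Bits m) (hψ : ‖ψ‖ ≤ 1) (hψ' : ‖ψ'‖ ≤ 1) :
    bestProb γ z ψ ≤ bestProb γ z ψ' + 2 * ‖ψ - ψ'‖ := by
  refine ciSup_le fun W => ?_
  have h1 := acceptProb_le_add γ z W.1.2 W.2.2 hψ hψ'
  have h2 := acceptProb_le_bestProb γ z W.1.2 W.2.2 hψ'
  linarith

theorem sum_acceptProb_le (γ : ℝ) (hγ0 : 0 ≤ γ) (hγ1 : γ < 1 / 2)
    (K : Bits m → Matrix (Bits m × EA) (Bits m × EA) ℂ)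
    (L : Bits m → Matrix (Bits m × EB) (Bits m × EB) ℂ)
    (hK : ∀ z, K z ∈ Matrix.unitaryGroup (Bits m × EA) ℂ)
    (hL : ∀ z, L z ∈ Matrix.unitaryGroup (Bits m × EB) ℂ) (hψ : ‖ψ‖ ≤ 1) :
    ∑ z, acceptProb γ z (K z) (L z) ψ ≤ 2 ^ m * muGamma γ ^ m := by
  simp only [acceptProb]
  rw [Finset.sum_comm]
  refine (Finset.sum_le_sum fun a _ => sum_norm_sq_pulledN_le K L hK hL a ψ hψ).trans ?_
  rw [← Finset.mul_sum]
  exact mul_le_mul_of_nonneg_left (sum_pow_hw_le γ hγ0 hγ1 m) (by positivity)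

theorem exists_bestProb_le_add (γ : ℝ) (z : Bits m) {η : ℝ} (hη : 0 < η) :
    ∃ K ∈ Matrix.unitaryGroup (Bits m × EA) ℂ, ∃ L ∈ Matrix.unitaryGroup (Bits m × EB) ℂ,
      bestProb γ z ψ ≤ acceptProb γ z K L ψ + η := by
  obtain ⟨W, hW⟩ := exists_lt_of_lt_ciSup (sub_lt_self (bestProb γ z ψ) hη)
  exact ⟨W.1.1, W.1.2, W.2.1, W.2.2, by linarith⟩

theorem sum_bestProb_le (γ : ℝ) (hγ0 : 0 ≤ γ) (hγ1 : γ < 1 / 2) (hψ : ‖ψ‖ ≤ 1) :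
    ∑ z, bestProb γ z ψ ≤ 2 ^ m * muGamma γ ^ m := by
  refine le_of_forall_pos_le_add fun η hη => ?_
  have hη' : 0 < η / 2 ^ m := by positivity
  choose K hK L hL h using fun z => exists_bestProb_le_add (ψ := ψ) γ z hη'
  have h2 : ∑ _z : Bits m, η / 2 ^ m = η := by
    rw [Finset.sum_const, Finset.card_univ, Fintype.card_fun, Fintype.card_bool, Fintype.card_fin,
      nsmul_eq_mul]
    push_cast
    field_simp
  have h3 := Finset.sum_le_sum fun z (_ : z ∈ Finset.univ) => h z
  rw [Finset.sum_add_distrib, h2] at h3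
  linarith [sum_acceptProb_le γ hγ0 hγ1 K L hK hL hψ]

theorem sum_re_dotProduct_Nmat (γ : ℝ) (z : Bits m)
    (hK : K ∈ Matrix.unitaryGroup (Bits m × EA) ℂ) (hL : L ∈ Matrix.unitaryGroup (Bits m × EB) ℂ)
    (v : Bits m × (Bits m × EA) × (Bits m × EB) → ℂ) :
    ∑ a ∈ accepted γ m, (star ((respond K L).mulVec v) ⬝ᵥ
      (Nmat m z a).mulVec ((respond K L).mulVec v)).re =
        acceptProb γ z K L (WithLp.toLp 2 v) := by
  refine Finset.sum_congr rfl fun a _ => ?_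
  have h := norm_sq_apply_of_isProj ((isSelfAdjoint_pulledN (K := K) (L := L) z a).map
      (Matrix.toEuclideanCLM (𝕜 := ℂ)))
    (by rw [← map_mul, pulledN_mul_self hK hL]) (WithLp.toLp 2 v)
  rw [← Complex.ofReal_re (‖_‖ ^ 2), ← h, Matrix.toEuclideanCLM_toLp,
    EuclideanSpace.inner_toLp_toLp, Matrix.star_mulVec, ← Matrix.dotProduct_mulVec, pulledN,
    dotProduct_comm (Matrix.mulVec _ _)]
  simp only [Matrix.mulVec_mulVec, Matrix.star_eq_conjTranspose, Matrix.mul_assoc]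

end Acceptance

section Nets

open Module MeasureTheory Metric

open scoped ENNReal

variable {E : Type*} [NormedAddCommGroup E] [NormedSpace ℝ E] [FiniteDimensional ℝ E]

theorem card_le_of_separated_unit_ball {δ : ℝ} (hδ : 0 < δ) (s : Finset E)
    (hs : ∀ x ∈ s, ‖x‖ ≤ 1) (h : ∀ x ∈ s, ∀ y ∈ s, x ≠ y → δ ≤ ‖x - y‖) :
    (s.card : ℝ) ≤ (1 + 2 / δ) ^ finrank ℝ E := by
  borelize E
  let μ : Measure E := Measure.addHaar
  have hρ : 0 < 1 + δ / 2 := by positivity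
  have hδ2 : 0 < δ / 2 := by positivity
  have hdisj : Set.Pairwise (s : Set E) (Function.onFun Disjoint fun c => ball (c : E) (δ / 2)) := by
    rintro x hx y hy hxy
    apply ball_disjoint_ball
    rw [dist_eq_norm]
    linarith [h x hx y hy hxy]
  have hsub : (⋃ c ∈ s, ball (c : E) (δ / 2)) ⊆ ball (0 : E) (1 + δ / 2) := by
    refine Set.iUnion₂_subset fun x hx => ball_subset_ball' ?_
    rw [dist_zero_right]
    linarith [hs x hx]
  have hvol : (s.card : ℝ≥0∞) * ENNReal.ofReal ((δ / 2) ^ finrank ℝ E) * μ (ball 0 1) ≤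
      ENNReal.ofReal ((1 + δ / 2) ^ finrank ℝ E) * μ (ball 0 1) :=
    calc (s.card : ℝ≥0∞) * ENNReal.ofReal ((δ / 2) ^ finrank ℝ E) * μ (ball 0 1)
        = μ (⋃ c ∈ s, ball (c : E) (δ / 2)) := by
          rw [measure_biUnion_finset hdisj fun c _ => measurableSet_ball]
          simp only [μ.addHaar_ball_of_pos _ hδ2]
          simp only [Finset.sum_const, nsmul_eq_mul, mul_assoc]
      _ ≤ μ (ball (0 : E) (1 + δ / 2)) := measure_mono hsub
      _ = ENNReal.ofReal ((1 + δ / 2) ^ finrank ℝ E) * μ (ball 0 1) := by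
          simp only [μ.addHaar_ball_of_pos _ hρ]
  have hvol' : (s.card : ℝ≥0∞) * ENNReal.ofReal ((δ / 2) ^ finrank ℝ E) ≤
      ENNReal.ofReal ((1 + δ / 2) ^ finrank ℝ E) :=
    (ENNReal.mul_le_mul_iff_left (measure_ball_pos _ _ zero_lt_one).ne' measure_ball_lt_top.ne).1
      hvol
  have hreal := ENNReal.toReal_le_of_le_ofReal (pow_nonneg hρ.le _) hvol'
  rw [ENNReal.toReal_mul, ENNReal.toReal_natCast, ENNReal.toReal_ofReal (by positivity),
    ← le_div_iff₀ (by positivity), ← div_pow] at hreal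
  refine hreal.trans_eq ?_
  congr 1
  field_simp
  ring

theorem exists_finset_net {δ : ℝ} (hδ : 0 < δ) (S : Set E) (hS : ∀ x ∈ S, ‖x‖ ≤ 1) :
    ∃ N : Finset E, (∀ x ∈ N, x ∈ S) ∧ (∀ x ∈ S, ∃ y ∈ N, ‖x - y‖ ≤ δ) ∧
      (N.card : ℝ) ≤ (1 + 2 / δ) ^ finrank ℝ E := by
  classical
  let p : ℕ → Prop := fun k => ∃ N : Finset E, (∀ x ∈ N, x ∈ S) ∧
    (∀ x ∈ N, ∀ y ∈ N, x ≠ y → δ ≤ ‖x - y‖) ∧ N.card = k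
  have hbound : ∀ k, p k → k ≤ ⌊(1 + 2 / δ) ^ finrank ℝ E⌋₊ := by
    rintro k ⟨N, hN, hsep, rfl⟩
    exact Nat.le_floor (card_le_of_separated_unit_ball hδ N (fun x hx => hS x (hN x hx)) hsep)
  have hp0 : p 0 := ⟨∅, by simp, by simp, rfl⟩
  obtain ⟨N, hN, hsep, hcard⟩ := Nat.findGreatest_spec (P := p)
    (Nat.zero_le ⌊(1 + 2 / δ) ^ finrank ℝ E⌋₊) hp0
  refine ⟨N, hN, fun x hx => ?_,
    card_le_of_separated_unit_ball hδ N (fun x hx => hS x (hN x hx)) hsep⟩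
  by_contra! hfar
  have hxN : x ∉ N := fun h => absurd (hfar x h) (by simpa using hδ.le)
  have hp : p (N.card + 1) := by
    refine ⟨insert x N, fun y hy => ?_, fun y hy w hw hyw => ?_, Finset.card_insert_of_notMem hxN⟩
    · rcases Finset.mem_insert.1 hy with rfl | hy
      exacts [hx, hN y hy]
    · rcases Finset.mem_insert.1 hy with rfl | hy' <;> rcases Finset.mem_insert.1 hw with rfl | hw'
      · exact absurd rfl hyw
      · exact (hfar w hw').le
      · rw [norm_sub_rev]; exact (hfar y hy').le
      · exact hsep y hy' w hw' hyw
  have := Nat.le_findGreatest (P := p) (hbound (N.card + 1) hp) hp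
  omega

end Nets

section Evolution

open scoped Matrix.Norms.L2Operator

theorem finrank_real_matrix (A : Type*) [Fintype A] :
    Module.finrank ℝ (Matrix A A ℂ) = 2 * Fintype.card A ^ 2 := by
  rw [finrank_real_of_complex, Module.finrank_matrix, Module.finrank_self, mul_one, sq]

variable {I A B : Type*} [Fintype I] [DecidableEq I] [Fintype A] [DecidableEq A]
  [Fintype B] [DecidableEq B]

theorem norm_apply_le_of_starHom {X Y : Type*} [Fintype X] [DecidableEq X] [Fintype Y]
    [DecidableEq Y] (F : Matrix X X ℂ →⋆ₙₐ[ℂ] Matrix Y Y ℂ) (M : Matrix X X ℂ) : ‖F M‖ ≤ ‖M‖ :=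
  NonUnitalStarAlgHom.norm_apply_le F M

theorem norm_one_kronecker_le (U : Matrix A A ℂ) :
    ‖(1 : Matrix I I ℂ) ⊗ₖ (U ⊗ₖ (1 : Matrix B B ℂ))‖ ≤ ‖U‖ :=
  norm_apply_le_of_starHom
    { toFun := fun U : Matrix A A ℂ => (1 : Matrix I I ℂ) ⊗ₖ (U ⊗ₖ (1 : Matrix B B ℂ))
      map_smul' := fun c X => by
        simp [Matrix.smul_kronecker, Matrix.kronecker_smul]
      map_zero' := by simp
      map_add' := fun X Y => by simp [Matrix.add_kronecker, Matrix.kronecker_add]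
      map_mul' := fun X Y => by simp [← Matrix.mul_kronecker_mul]
      map_star' := fun X => by
        simp [Matrix.star_eq_conjTranspose, Matrix.conjTranspose_kronecker] } U

theorem norm_one_kronecker_one_le (V : Matrix B B ℂ) :
    ‖(1 : Matrix I I ℂ) ⊗ₖ ((1 : Matrix A A ℂ) ⊗ₖ V)‖ ≤ ‖V‖ :=
  norm_apply_le_of_starHom
    { toFun := fun V : Matrix B B ℂ => (1 : Matrix I I ℂ) ⊗ₖ ((1 : Matrix A A ℂ) ⊗ₖ V)
      map_smul' := fun c X => by
        simp [Matrix.kronecker_smul]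
      map_zero' := by simp
      map_add' := fun X Y => by simp [Matrix.kronecker_add]
      map_mul' := fun X Y => by simp [← Matrix.mul_kronecker_mul]
      map_star' := fun X => by
        simp [Matrix.star_eq_conjTranspose, Matrix.conjTranspose_kronecker] } V

/-- The state `(I ⊗ U ⊗ V)φ`. -/
def evolve (U : Matrix A A ℂ) (V : Matrix B B ℂ) (φ : EuclideanSpace ℂ (I × A × B)) :
    EuclideanSpace ℂ (I × A × B) :=
  Matrix.toEuclideanCLM (𝕜 := ℂ) ((1 : Matrix I I ℂ) ⊗ₖ (U ⊗ₖ V)) φ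

theorem norm_le_one_of_mem_unitary {U : Matrix A A ℂ} (hU : U ∈ Matrix.unitaryGroup A ℂ) :
    ‖U‖ ≤ 1 := by
  rcases isEmpty_or_nonempty A with h | h
  · rw [Subsingleton.elim U 0, norm_zero]; exact zero_le_one
  · exact (CStarRing.norm_of_mem_unitary hU).le

theorem norm_evolve_le (U : Matrix A A ℂ) (V : Matrix B B ℂ)
    (φ : EuclideanSpace ℂ (I × A × B)) : ‖evolve U V φ‖ ≤ ‖U‖ * ‖V‖ * ‖φ‖ := by
  have h : (1 : Matrix I I ℂ) ⊗ₖ (U ⊗ₖ V) =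
      ((1 : Matrix I I ℂ) ⊗ₖ (U ⊗ₖ (1 : Matrix B B ℂ))) *
        ((1 : Matrix I I ℂ) ⊗ₖ ((1 : Matrix A A ℂ) ⊗ₖ V)) := by
    simp [← Matrix.mul_kronecker_mul]
  rw [evolve]
  refine (ContinuousLinearMap.le_opNorm _ _).trans (mul_le_mul_of_nonneg_right ?_ (norm_nonneg _))
  rw [h, map_mul]
  refine (norm_mul_le _ _).trans ?_
  gcongr
  · exact norm_one_kronecker_le U
  · exact norm_one_kronecker_one_le V

theorem norm_evolve_sub_le {U U' : Matrix A A ℂ} {V V' : Matrix B B ℂ}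
    (hU : U ∈ Matrix.unitaryGroup A ℂ) (hU' : U' ∈ Matrix.unitaryGroup A ℂ)
    (hV : V ∈ Matrix.unitaryGroup B ℂ) (hV' : V' ∈ Matrix.unitaryGroup B ℂ)
    {φ φ' : EuclideanSpace ℂ (I × A × B)} (hφ : ‖φ‖ ≤ 1) :
    ‖evolve U V φ - evolve U' V' φ'‖ ≤ ‖φ - φ'‖ + ‖U - U'‖ + ‖V - V'‖ := by
  have h : evolve U V φ - evolve U' V' φ' =
      evolve U' V' (φ - φ') + evolve (U - U') V φ + evolve U' (V - V') φ := by
    simp only [evolve, sub_eq_add_neg, Matrix.add_kronecker, Matrix.kronecker_add, map_add,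
      ← neg_one_smul ℂ V', ← neg_one_smul ℂ U', Matrix.smul_kronecker, Matrix.kronecker_smul,
      map_smul, map_neg]
    simp only [_root_.add_apply, _root_.smul_apply]
    module
  have nU := norm_le_one_of_mem_unitary hU
  have nU' := norm_le_one_of_mem_unitary hU'
  have nV := norm_le_one_of_mem_unitary hV
  have nV' := norm_le_one_of_mem_unitary hV'
  rw [h]
  refine (norm_add₃_le).trans (add_le_add (add_le_add ?_ ?_) ?_)
  · refine (norm_evolve_le _ _ _).trans (mul_le_of_le_one_left (norm_nonneg _) ?_)
    exact mul_le_one₀ nU' (norm_nonneg _) nV'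
  · refine (norm_evolve_le _ _ _).trans ?_
    rw [mul_assoc]
    exact mul_le_of_le_one_right (norm_nonneg _) (mul_le_one₀ nV (norm_nonneg _) hφ)
  · refine (norm_evolve_le _ _ _).trans ?_
    rw [mul_comm ‖U'‖, mul_assoc]
    exact mul_le_of_le_one_right (norm_nonneg _) (mul_le_one₀ nU' (norm_nonneg _) hφ)

theorem norm_evolve_le_one {U : Matrix A A ℂ} {V : Matrix B B ℂ}
    (hU : U ∈ Matrix.unitaryGroup A ℂ) (hV : V ∈ Matrix.unitaryGroup B ℂ)
    {φ : EuclideanSpace ℂ (I × A × B)} (hφ : ‖φ‖ ≤ 1) : ‖evolve U V φ‖ ≤ 1 :=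
  (norm_evolve_le U V φ).trans (mul_le_one₀ (mul_le_one₀ (norm_le_one_of_mem_unitary hU)
    (norm_nonneg _) (norm_le_one_of_mem_unitary hV)) (norm_nonneg _) hφ)

theorem exists_finset_unitary_net {δ : ℝ} (hδ : 0 < δ) (A : Type*) [Fintype A] [DecidableEq A] :
    ∃ N : Finset (Matrix A A ℂ), (∀ U ∈ N, U ∈ Matrix.unitaryGroup A ℂ) ∧
      (∀ U ∈ Matrix.unitaryGroup A ℂ, ∃ U' ∈ N, ‖U - U'‖ ≤ δ) ∧
      (N.card : ℝ) ≤ (1 + 2 / δ) ^ (2 * Fintype.card A ^ 2) := by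
  rw [← finrank_real_matrix A]
  exact exists_finset_net hδ (Matrix.unitaryGroup A ℂ : Set (Matrix A A ℂ))
    fun U hU => norm_le_one_of_mem_unitary hU

variable {m n : ℕ} {EA EB : Type*} [DecidableEq EA] [DecidableEq EB] [Fintype EA] [Fintype EB]

/-- Relabelling of the basis of the provers' registers. -/
def regroup (σ : Bits m × (Bits m × EA) × (Bits m × EB) ≃ Bits m × A × B) :
    EuclideanSpace ℂ (Bits m × A × B) ≃ₗᵢ[ℂ]
      EuclideanSpace ℂ (Bits m × (Bits m × EA) × (Bits m × EB)) :=
  LinearIsometryEquiv.piLpCongrLeft 2 ℂ ℂ σ.symm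

theorem exists_finset_bestProb (γ : ℝ) (hγ0 : 0 ≤ γ) (hγ1 : γ < 1 / 2)
    (σ : Bits m × (Bits m × EA) × (Bits m × EB) ≃ Bits m × A × B) {δ : ℝ} (hδ : 0 < δ) :
    ∃ G : Finset (Bits n × Bits n → Bits m → ℝ),
      (G.card : ℝ) ≤ (1 + 2 / δ) ^ (2 * Fintype.card (Bits m × A × B) +
        (2 * Fintype.card A ^ 2 * 2 ^ n + 2 * Fintype.card B ^ 2 * 2 ^ n)) ∧
      (∀ g ∈ G, ∀ p, (∀ z, 0 ≤ g p z) ∧ (∀ z, g p z ≤ 1) ∧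
        ∑ z, g p z ≤ 2 ^ m * muGamma γ ^ m) ∧
      ∀ φ : EuclideanSpace ℂ (Bits m × A × B), ‖φ‖ ≤ 1 →
        ∀ U : Bits n → Matrix A A ℂ, (∀ x, U x ∈ Matrix.unitaryGroup A ℂ) →
        ∀ V : Bits n → Matrix B B ℂ, (∀ y, V y ∈ Matrix.unitaryGroup B ℂ) →
        ∃ g ∈ G, ∀ x y z,
          bestProb γ z (regroup σ (evolve (U x) (V y) φ)) ≤ g (x, y) z + 6 * δ := by
  classical
  obtain ⟨Nφ, hNφ, hNφ', cNφ⟩ := exists_finset_net hδ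
    {φ : EuclideanSpace ℂ (Bits m × A × B) | ‖φ‖ ≤ 1} fun _ h => h
  obtain ⟨NA, hNA, hNA', cNA⟩ := exists_finset_unitary_net hδ A
  obtain ⟨NB, hNB, hNB', cNB⟩ := exists_finset_unitary_net hδ B
  rw [finrank_real_of_complex, finrank_euclideanSpace] at cNφ
  have hC : 0 ≤ 1 + 2 / δ := by positivity
  let F : EuclideanSpace ℂ (Bits m × A × B) × (Bits n → Matrix A A ℂ) × (Bits n → Matrix B B ℂ) →
      Bits n × Bits n → Bits m → ℝ := fun w p z =>
    bestProb γ z (regroup σ (evolve (w.2.1 p.1) (w.2.2 p.2) w.1))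
  refine ⟨(Nφ ×ˢ (Fintype.piFinset (fun _ => NA) ×ˢ Fintype.piFinset (fun _ => NB))).image F,
    ?_, fun g hg p => ?_, fun φ hφ U hU V hV => ?_⟩
  · refine (Nat.cast_le.2 Finset.card_image_le).trans ?_
    rw [Finset.card_product, Finset.card_product, Fintype.card_piFinset,
      Fintype.card_piFinset, Finset.prod_const, Finset.prod_const, Finset.card_univ,
      Fintype.card_fun, Fintype.card_bool, Fintype.card_fin, pow_add,
      pow_add, pow_mul _ _ (2 ^ n), pow_mul _ _ (2 ^ n)]
    push_cast
    gcongr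
  · obtain ⟨w, hw, rfl⟩ := Finset.mem_image.1 hg
    rw [Finset.mem_product, Finset.mem_product, Fintype.mem_piFinset, Fintype.mem_piFinset] at hw
    have hn : ‖regroup σ (evolve (w.2.1 p.1) (w.2.2 p.2) w.1)‖ ≤ 1 := by
      rw [LinearIsometryEquiv.norm_map]
      exact norm_evolve_le_one (hNA _ (hw.2.1 _)) (hNB _ (hw.2.2 _)) (hNφ _ hw.1)
    exact ⟨fun z => bestProb_nonneg γ z, fun z => bestProb_le_one γ z hn,
      sum_bestProb_le γ hγ0 hγ1 hn⟩
  · obtain ⟨φ', hφ'N, hφ'⟩ := hNφ' φ hφ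
    choose U' hU'N hU' using fun x => hNA' (U x) (hU x)
    choose V' hV'N hV' using fun y => hNB' (V y) (hV y)
    refine ⟨F (φ', U', V'), Finset.mem_image_of_mem F ?_, fun x y z => ?_⟩
    · rw [Finset.mem_product, Finset.mem_product, Fintype.mem_piFinset, Fintype.mem_piFinset]
      exact ⟨hφ'N, hU'N, hV'N⟩
    · refine (bestProb_le_add γ z
        (ψ' := regroup σ (evolve (U' x) (V' y) φ')) ?_ ?_).trans ?_
      · rw [LinearIsometryEquiv.norm_map]
        exact norm_evolve_le_one (hU x) (hV y) hφ
      · rw [LinearIsometryEquiv.norm_map]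
        exact norm_evolve_le_one (hNA _ (hU'N x)) (hNB _ (hV'N y)) (hNφ _ hφ'N)
      · rw [← map_sub, LinearIsometryEquiv.norm_map]
        have := norm_evolve_sub_le (hU x) (hNA _ (hU'N x)) (hV y) (hNB _ (hV'N y))
          (φ' := φ') hφ
        have e : F (φ', U', V') (x, y) z = bestProb γ z (regroup σ (evolve (U' x) (V' y) φ')) := rfl
        rw [e]
        linarith [hU' x, hV' y]

end Evolution

section Strategies

/-- Regrouping the qubits of a pair of registers. -/
def resplit {m r p s : ℕ} (h : p + s = m + r) : Bits m × Bits r ≃ Bits p × Bits s where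
  toFun w := splitBits (castBits h.symm (Fin.append w.1 w.2))
  invFun w := splitBits (castBits h (Fin.append w.1 w.2))
  left_inv w := by
    have h1 : ∀ {a b : ℕ} (v : Bits (a + b)), Fin.append (splitBits v).1 (splitBits v).2 = v :=
      fun v => Fin.append_castAdd_natAdd
    beta_reduce
    rw [h1]
    ext i <;> simp [splitBits, castBits]
  right_inv w := by
    have h1 : ∀ {a b : ℕ} (v : Bits (a + b)), Fin.append (splitBits v).1 (splitBits v).2 = v :=
      fun v => Fin.append_castAdd_natAdd
    beta_reduce
    rw [h1]
    ext i <;> simp [splitBits, castBits]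

/-- Swapping the communicated registers. -/
def exchange (I A₁ A₂ B₁ B₂ : Type*) :
    I × (A₁ × B₂) × (B₁ × A₂) ≃ I × (A₁ × A₂) × (B₁ × B₂) where
  toFun u := (u.1, (u.2.1.1, u.2.2.2), (u.2.2.1, u.2.1.2))
  invFun u := (u.1, (u.2.1.1, u.2.2.2), (u.2.2.1, u.2.1.2))
  left_inv _ := rfl
  right_inv _ := rfl

variable {n m q : ℕ}

/-- The identification of the registers before and after the communication. -/
def RoutStrategy.registers (T : RoutStrategy n m q) :
    Bits m × (Bits m × Bits T.rA) × (Bits m × Bits T.rB) ≃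
      Bits m × (Bits T.qAk × Bits T.qAc) × (Bits T.qBk × Bits T.qBc) :=
  ((Equiv.refl _).prodCongr ((resplit T.hrA).prodCongr (resplit T.hrB))).trans
    (exchange _ _ _ _ _)

/-- The state held by the provers after the communication. -/
def RoutStrategy.held (T : RoutStrategy n m q) (x y : Bits n) :
    EuclideanSpace ℂ (Bits m × (Bits m × Bits T.rA) × (Bits m × Bits T.rB)) :=
  regroup T.registers (evolve (T.U x) (T.V y) (WithLp.toLp 2 T.φ))

theorem RoutStrategy.Psi_eq (T : RoutStrategy n m q) (x y : Bits n) :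
    T.Psi x y = (respond ((T.K x y).submatrix (resplit T.hrA) (resplit T.hrA))
      ((T.L x y).submatrix (resplit T.hrB) (resplit T.hrB))).mulVec (T.held x y).ofLp := by
  set τ := (Equiv.refl (Bits m)).prodCongr ((resplit T.hrA).prodCongr (resplit T.hrB)) with hτ
  have hM : respond ((T.K x y).submatrix (resplit T.hrA) (resplit T.hrA))
      ((T.L x y).submatrix (resplit T.hrB) (resplit T.hrB)) =
      ((1 : Matrix (Bits m) (Bits m) ℂ) ⊗ₖ (T.K x y ⊗ₖ T.L x y)).submatrix τ τ := rfl
  rw [hM, Matrix.submatrix_mulVec_equiv]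
  refine congrArg (fun v => (((1 : Matrix (Bits m) (Bits m) ℂ) ⊗ₖ
    (T.K x y ⊗ₖ T.L x y)).mulVec v) ∘ τ) ?_
  funext u
  have h : (T.held x y).ofLp (τ.symm u) =
      (evolve (T.U x) (T.V y) (WithLp.toLp 2 T.φ)).ofLp (T.registers (τ.symm u)) := rfl
  rw [Function.comp_apply, h, registers, Equiv.trans_apply, ← hτ, Equiv.apply_symm_apply]
  rfl

theorem submatrix_mem_unitary {X Y : Type*} [Fintype X] [DecidableEq X] [Fintype Y] [DecidableEq Y]
    (e : X ≃ Y) {M : Matrix Y Y ℂ} (hM : M ∈ Matrix.unitaryGroup Y ℂ) :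
    M.submatrix e e ∈ Matrix.unitaryGroup X ℂ := by
  rw [Matrix.mem_unitaryGroup_iff, Matrix.star_eq_conjTranspose, Matrix.conjTranspose_submatrix,
    Matrix.submatrix_mul_equiv, ← Matrix.star_eq_conjTranspose, Matrix.mem_unitaryGroup_iff.1 hM,
    Matrix.submatrix_one_equiv]

theorem RoutStrategy.norm_φ (T : RoutStrategy n m q) : ‖WithLp.toLp 2 T.φ‖ = 1 := by
  rw [EuclideanSpace.norm_eq]
  simp [T.hφ]

theorem RoutStrategy.norm_held_le (T : RoutStrategy n m q) (x y : Bits n) : ‖T.held x y‖ ≤ 1 := by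
  rw [held, LinearIsometryEquiv.norm_map]
  exact norm_evolve_le_one (T.hU x) (T.hV y) T.norm_φ.le

theorem RoutStrategy.win_le (T : RoutStrategy n m q) (γ : ℝ) (f : Bits n × Bits n → Bits m) :
    T.win γ f ≤ (1 / 2 ^ (2 * n) : ℝ) * ∑ x, ∑ y, bestProb γ (f (x, y)) (T.held x y) := by
  refine mul_le_mul_of_nonneg_left (Finset.sum_le_sum fun x _ => Finset.sum_le_sum fun y _ => ?_)
    (by positivity)
  have hK := submatrix_mem_unitary (resplit T.hrA) (T.hK x y)
  have hL := submatrix_mem_unitary (resplit T.hrB) (T.hL x y)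
  rw [T.Psi_eq]
  exact (sum_re_dotProduct_Nmat γ (f (x, y)) hK hL _).trans_le
    (acceptProb_le_bestProb γ _ hK hL (T.norm_held_le x y))

theorem exists_finset_win (γ : ℝ) (hγ0 : 0 ≤ γ) (hγ1 : γ < 1 / 2) (hnm : m < n) (qAk qBk : ℕ)
    {δ : ℝ} (hδ : 0 < δ) :
    ∃ G : Finset (Bits n × Bits n → Bits m → ℝ),
      (G.card : ℝ) ≤ (1 + 2 / δ) ^ (5 * 2 ^ n * 4 ^ q) ∧
      (∀ g ∈ G, ∀ p, (∀ z, 0 ≤ g p z) ∧ (∀ z, g p z ≤ 1) ∧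
        ∑ z, g p z ≤ 2 ^ m * muGamma γ ^ m) ∧
      ∀ T : RoutStrategy n m q, T.qAk = qAk → T.qBk = qBk → ∃ g ∈ G,
        ∀ f : Bits n × Bits n → Bits m,
          T.win γ f ≤ (1 / 2 ^ (2 * n) : ℝ) * ∑ p, g p (f p) + 6 * δ := by
  have hC : 1 ≤ 1 + 2 / δ := le_add_of_nonneg_right (by positivity)
  by_cases hT : ∃ T₀ : RoutStrategy n m q, T₀.qAk = qAk ∧ T₀.qBk = qBk
  swap
  · exact ⟨∅, by simp; positivity, by simp, fun T h1 h2 => absurd ⟨T, h1, h2⟩ hT⟩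
  obtain ⟨T₀, rfl, rfl⟩ := hT
  obtain ⟨G, hG1, hG2, hG3⟩ := exists_finset_bestProb (n := n) γ hγ0 hγ1 T₀.registers hδ
  refine ⟨G, hG1.trans (pow_le_pow_right₀ hC ?_), hG2, fun T h1 h2 => ?_⟩
  · have hA : Fintype.card (Bits T₀.qAk × Bits T₀.qAc) = 2 ^ q := by
      rw [Fintype.card_prod]; simp only [Fintype.card_fun, Fintype.card_bool, Fintype.card_fin]
      rw [← pow_add, T₀.hqA]
    have hB : Fintype.card (Bits T₀.qBk × Bits T₀.qBc) = 2 ^ q := by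
      rw [Fintype.card_prod]; simp only [Fintype.card_fun, Fintype.card_bool, Fintype.card_fin]
      rw [← pow_add, T₀.hqB]
    rw [Fintype.card_prod, Fintype.card_prod, hA, hB]
    simp only [Fintype.card_fun, Fintype.card_bool, Fintype.card_fin]
    have h4 : (2 : ℕ) ^ q * 2 ^ q = 4 ^ q := by rw [← mul_pow]; norm_num
    have h5 : 2 * 2 ^ m ≤ 2 ^ n := by
      rw [← pow_succ']; exact Nat.pow_le_pow_right (by norm_num) hnm
    rw [sq, h4]
    nlinarith [Nat.mul_le_mul_right (4 ^ q) h5]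
  · suffices h : ∃ g ∈ G, ∀ x y z, bestProb γ z (T.held x y) ≤ g (x, y) z + 6 * δ by
      obtain ⟨g, hg, h⟩ := h
      refine ⟨g, hg, fun f => (T.win_le γ f).trans ?_⟩
      have h3 : ∑ x, ∑ y, bestProb γ (f (x, y)) (T.held x y) ≤
          ∑ p, g p (f p) + 2 ^ (2 * n) * (6 * δ) := by
        rw [Fintype.sum_prod_type]
        refine (Finset.sum_le_sum fun x _ => Finset.sum_le_sum fun y _ =>
          h x y (f (x, y))).trans_eq ?_
        simp only [Finset.sum_add_distrib, Finset.sum_const, Finset.card_univ, Fintype.card_fun,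
          Fintype.card_bool, Fintype.card_fin, nsmul_eq_mul]
        push_cast
        ring
      refine (mul_le_mul_of_nonneg_left h3 (by positivity)).trans_eq ?_
      field_simp
    have e : T.qAc = T₀.qAc ∧ T.qBc = T₀.qBc ∧ T.rA = T₀.rA ∧ T.rB = T₀.rB := by
      have := T.hqA; have := T.hqB; have := T.hrA; have := T.hrB
      have := T₀.hqA; have := T₀.hqB; have := T₀.hrA; have := T₀.hrB
      omega
    clear hG1 hG2
    obtain ⟨qAk, qAc, qBk, qBc, rA, rB, hqA, hqB, hrA, hrB, φ, hφ, U, V, hU, hV, K, L, hK, hL⟩ := T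
    obtain ⟨qAk₀, qAc₀, qBk₀, qBc₀, rA₀, rB₀, hqA₀, hqB₀, hrA₀, hrB₀, φ₀, hφ₀, U₀, V₀, hU₀, hV₀, K₀,
      L₀, hK₀, hL₀⟩ := T₀
    obtain ⟨e1, e2, e3, e4⟩ := e
    dsimp only at h1 h2 e1 e2 e3 e4
    subst h1 h2 e1 e2 e3 e4
    refine hG3 (WithLp.toLp 2 φ) ?_ U hU V hV
    rw [EuclideanSpace.norm_eq]
    simp [hφ]

end Strategies

section Chernoff

variable {α β : Type*} [Fintype α] [DecidableEq α] [Fintype β]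

theorem card_filter_le_of_sum_exp_le (g : α → β → ℝ) (κ θ : ℝ)
    (hg : ∀ p, ∑ z, Real.exp (g p z) ≤ Fintype.card β * Real.exp κ) :
    ((univ.filter fun f : α → β => θ ≤ ∑ p, g p (f p)).card : ℝ) ≤
      (Fintype.card β : ℝ) ^ Fintype.card α * Real.exp (Fintype.card α * κ - θ) := by
  have h1 : ((univ.filter fun f : α → β => θ ≤ ∑ p, g p (f p)).card : ℝ) * Real.exp θ ≤
      ∑ f : α → β, Real.exp (∑ p, g p (f p)) := by
    rw [← nsmul_eq_mul]
    refine (Finset.card_nsmul_le_sum _ (fun f : α → β => Real.exp (∑ p, g p (f p))) _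
      fun f hf => Real.exp_le_exp.2 (mem_filter.1 hf).2).trans ?_
    exact Finset.sum_le_sum_of_subset_of_nonneg (filter_subset _ _)
      fun _ _ _ => (Real.exp_pos _).le
  have h2 : ∑ f : α → β, Real.exp (∑ p, g p (f p)) = ∏ p, ∑ z, Real.exp (g p z) := by
    rw [Finset.prod_univ_sum, Fintype.piFinset_univ]
    exact Finset.sum_congr rfl fun f _ => Real.exp_sum _ _
  have h3 : ∏ p, ∑ z, Real.exp (g p z) ≤ (Fintype.card β * Real.exp κ) ^ Fintype.card α := by
    rw [← Finset.card_univ (α := α), ← Finset.prod_const]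
    exact Finset.prod_le_prod (fun _ _ => Finset.sum_nonneg fun _ _ => (Real.exp_pos _).le)
      fun p _ => hg p
  rw [Real.exp_sub, Real.exp_nat_mul, ← mul_div_assoc, ← mul_pow, le_div_iff₀ (Real.exp_pos _)]
  exact h1.trans (h2.trans_le h3)

/-- A multiplicative Chernoff bound for sums of independent `[0, 1]`-valued variables with means at
most `π`. -/
theorem card_filter_le_of_mean_le (g : α → β → ℝ) {π s : ℝ} (t : ℝ) (hπ : 0 < π) (hs : π ≤ s)
    (h0 : ∀ p z, 0 ≤ g p z) (h1 : ∀ p z, g p z ≤ 1)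
    (hg : ∀ p, ∑ z, g p z ≤ Fintype.card β * π) :
    ((univ.filter fun f : α → β => Fintype.card α * t ≤ ∑ p, g p (f p)).card : ℝ) ≤
      (Fintype.card β : ℝ) ^ Fintype.card α *
        Real.exp (-(Fintype.card α * Real.log (s / π) * (t - s))) := by
  have hs0 : 0 < s := hπ.trans_le hs
  set l := Real.log (s / π) with hl
  have hl0 : 0 ≤ l := Real.log_nonneg ((one_le_div hπ).2 hs)
  have hel : Real.exp l = s / π := Real.exp_log (by positivity)
  have key := card_filter_le_of_sum_exp_le (fun p z => l * g p z) (s - π)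
    (Fintype.card α * (l * t)) fun p => ?_
  · refine (Nat.cast_le.2 (card_le_card fun f hf => ?_)).trans
      (key.trans (mul_le_mul_of_nonneg_left (Real.exp_le_exp.2 ?_) (by positivity)))
    · simp only [mem_filter, mem_univ, true_and] at hf ⊢
      rw [← Finset.mul_sum]
      calc _ = l * (Fintype.card α * t) := by ring
        _ ≤ _ := mul_le_mul_of_nonneg_left hf hl0
    · have h2 : s - π ≤ l * s := by
        have := Real.one_sub_inv_le_log_of_pos (x := s / π) (by positivity)
        rw [inv_div, ← hl] at this
        calc s - π = (1 - π / s) * s := by field_simp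
          _ ≤ l * s := mul_le_mul_of_nonneg_right this hs0.le
      calc _ ≤ Fintype.card α * (l * s) - Fintype.card α * (l * t) :=
            sub_le_sub_right (mul_le_mul_of_nonneg_left h2 (Nat.cast_nonneg _)) _
        _ = _ := by ring
  · have hc : ∀ z, Real.exp (l * g p z) ≤ 1 + (s / π - 1) * g p z := fun z => by
      have := convexOn_exp.2 (Set.mem_univ 0) (Set.mem_univ l) (sub_nonneg.2 (h1 p z)) (h0 p z)
        (by ring)
      simp only [smul_eq_mul, mul_zero, zero_add, Real.exp_zero, hel] at this
      calc _ = Real.exp (g p z * l) := by rw [mul_comm]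
        _ ≤ _ := this
        _ = _ := by ring
    calc ∑ z, Real.exp (l * g p z) ≤ ∑ z, (1 + (s / π - 1) * g p z) :=
          Finset.sum_le_sum fun z _ => hc z
      _ = Fintype.card β + (s / π - 1) * ∑ z, g p z := by
          rw [Finset.sum_add_distrib, ← Finset.mul_sum]; simp
      _ ≤ Fintype.card β + (s / π - 1) * (Fintype.card β * π) :=
          add_le_add_right (mul_le_mul_of_nonneg_left (hg p)
            (sub_nonneg.2 ((one_le_div hπ).2 hs))) _
      _ = Fintype.card β * ((s - π) + 1) := by field_simp; ring
      _ ≤ _ := mul_le_mul_of_nonneg_left (Real.add_one_le_exp _) (Nat.cast_nonneg _)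

theorem exp_le_one_add_add_sq {x : ℝ} (hx : |x| ≤ 1) : Real.exp x ≤ 1 + x + 3 / 4 * x ^ 2 := by
  have h := Real.exp_bound hx (n := 3) (by norm_num)
  simp only [Finset.sum_range_succ, Finset.sum_range_zero, Nat.factorial] at h
  norm_num at h
  have h3 : |x| ^ 3 ≤ x ^ 2 := by
    rw [← sq_abs x]; exact pow_le_pow_of_le_one (abs_nonneg _) hx (by norm_num)
  have := (abs_le.1 h).2
  nlinarith [sq_nonneg x]

theorem card_filter_fiber_le [DecidableEq β] (z : β) {l d : ℝ} (hl : |l| ≤ 1) (θ : ℝ)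
    (hθ : Fintype.card α * (l + d) ≤ Fintype.card β * θ) :
    ((univ.filter fun f : α → β =>
      θ ≤ l * ((univ.filter fun p => f p = z).card : ℝ)).card : ℝ) ≤
      (Fintype.card β : ℝ) ^ Fintype.card α *
        Real.exp (Fintype.card α / Fintype.card β * (3 / 4 * l ^ 2 - d)) := by
  have hβ : (0 : ℝ) < Fintype.card β := by
    exact_mod_cast Fintype.card_pos_iff.2 ⟨z⟩
  have key := card_filter_le_of_sum_exp_le (α := α) (fun _ z' => if z' = z then l else 0)
    ((l + 3 / 4 * l ^ 2) / Fintype.card β) θ fun p => ?_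
  · refine (Nat.cast_le.2 (card_le_card fun f hf => ?_)).trans
      (key.trans (mul_le_mul_of_nonneg_left (Real.exp_le_exp.2 ?_) (by positivity)))
    · simp only [mem_filter, mem_univ, true_and] at hf ⊢
      rw [← Finset.sum_filter, Finset.sum_const, nsmul_eq_mul, mul_comm]
      exact hf
    · rw [← sub_nonneg]
      have : 0 ≤ (Fintype.card β * θ - Fintype.card α * (l + d)) / Fintype.card β :=
        div_nonneg (sub_nonneg.2 hθ) hβ.le
      refine this.trans_eq ?_
      field_simp
      ring
  · calc ∑ z', Real.exp (if z' = z then l else 0)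
        = ∑ z', (1 + if z' = z then Real.exp l - 1 else 0) :=
          Finset.sum_congr rfl fun z' _ => by split_ifs <;> simp
      _ = Fintype.card β + (Real.exp l - 1) := by
          rw [Finset.sum_add_distrib, Finset.sum_ite_eq']; simp
      _ ≤ Fintype.card β + (l + 3 / 4 * l ^ 2) := by linarith [exp_le_one_add_add_sq hl]
      _ = Fintype.card β * ((l + 3 / 4 * l ^ 2) / Fintype.card β + 1) := by field_simp; ring
      _ ≤ _ := mul_le_mul_of_nonneg_left (Real.add_one_le_exp _) hβ.le

end Chernoff

section NearlyUniform

variable {n m : ℕ}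

theorem card_not_mem_Fstar_le {ε : ℝ} (hε0 : 0 < ε) (hε1 : ε ≤ 1)
    (hregime : Real.sqrt (3 * Real.log (2 / ε)) * (2 : ℝ) ^ (-(n : ℝ) + m / 2) < 1 / 4) :
    ((Fstar n m ε)ᶜ.ncard : ℝ) ≤ 2 ^ m * (ε * Fintype.card (Bits n × Bits n → Bits m)) := by
  classical
  set S := Real.sqrt (3 * Real.log (2 / ε)) with hS
  set δ := S * (2 : ℝ) ^ (-(n : ℝ) + m / 2) with hδ
  have hlog : 0 < Real.log (2 / ε) := Real.log_pos (by rw [lt_div_iff₀ hε0]; linarith)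
  have hδ0 : 0 < δ := mul_pos (Real.sqrt_pos.2 (by linarith)) (by positivity)
  have hα : (Fintype.card (Bits n × Bits n) : ℝ) = 2 ^ (2 * n) := by simp [two_mul, pow_add]
  have hβ : (Fintype.card (Bits m) : ℝ) = 2 ^ m := by simp
  have hN : (2 : ℝ) ^ (2 * n) / 2 ^ m * δ ^ 2 = 3 * Real.log (2 / ε) := by
    have h : ((2 : ℝ) ^ (-(n : ℝ) + m / 2)) ^ 2 = 2 ^ m / 2 ^ (2 * n) := by
      rw [← Real.rpow_natCast, ← Real.rpow_mul zero_le_two, ← Real.rpow_natCast 2 m,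
        ← Real.rpow_natCast 2 (2 * n), ← Real.rpow_sub zero_lt_two]
      congr 1
      push_cast
      ring
    rw [hδ, mul_pow, h, hS, Real.sq_sqrt (by linarith)]
    field_simp
  have hdev : S * (2 : ℝ) ^ (-(n : ℝ) - m / 2) = δ / 2 ^ m := by
    rw [hδ, mul_div_assoc, ← Real.rpow_natCast 2 m, ← Real.rpow_sub zero_lt_two]
    congr 2
    ring
  let B (σ : ℝ) (z : Bits m) : Finset (Bits n × Bits n → Bits m) := univ.filter fun f =>
    2 ^ (2 * n) / 2 ^ m * (σ * (2 / 3 * δ) + 2 / 3 * δ ^ 2) ≤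
      σ * (2 / 3 * δ) * ((univ.filter fun p => f p = z).card : ℝ)
  have hB : ∀ σ : ℝ, |σ| = 1 → ∀ z, ((B σ z).card : ℝ) ≤
      ε / 2 * Fintype.card (Bits n × Bits n → Bits m) := fun σ hσ z => by
    have hσ2 : σ ^ 2 = 1 := by rw [← sq_abs, hσ, one_pow]
    refine (card_filter_fiber_le (α := Bits n × Bits n) z (l := σ * (2 / 3 * δ))
      (d := 2 / 3 * δ ^ 2) ?_ _ ?_).trans_eq ?_
    · rw [abs_mul, hσ, one_mul, abs_of_pos (by positivity)]; linarith
    · rw [hα, hβ]; refine le_of_eq ?_; field_simp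
    · have h : 2 ^ (2 * n) / 2 ^ m * (3 / 4 * (σ * (2 / 3 * δ)) ^ 2 - 2 / 3 * δ ^ 2) =
          -Real.log (2 / ε) := by
        rw [mul_pow, hσ2]; linear_combination (-1 / 3) * hN
      rw [hα, hβ, h, Real.exp_neg, Real.exp_log (by positivity), Fintype.card_fun (α := _ × _)]
      push_cast
      rw [hβ, inv_div, mul_comm]
  have hsub : (Fstar n m ε)ᶜ ⊆ ((univ.biUnion fun z => B 1 z ∪ B (-1) z : Finset _) : Set _) := by
    intro f hf
    simp only [Fstar, Set.mem_compl_iff, Set.mem_ofPred_eq, not_forall, not_le] at hf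
    obtain ⟨z, hz⟩ := hf
    rw [← hS, hdev, Real.rpow_neg zero_le_two, Real.rpow_natCast, qf] at hz
    simp only [coe_biUnion, Set.mem_iUnion, mem_coe, mem_univ, mem_union]
    refine ⟨z, trivial, ?_⟩
    simp only [B, mem_filter, mem_univ, true_and]
    generalize ((univ.filter fun p => f p = z).card : ℝ) = k at hz ⊢
    have hk : k = 2 ^ (2 * n) * (k / 2 ^ (2 * n)) := by field_simp
    rw [hk]
    generalize k / 2 ^ (2 * n) = x at hz ⊢
    have h0 : (0 : ℝ) < 2 ^ (2 * n) * (2 / 3 * δ) := by positivity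
    rcases lt_abs.1 hz with h | h
    · left
      have := mul_le_mul_of_nonneg_left h.le h0.le
      rw [← sub_nonneg] at this ⊢
      refine this.trans_eq ?_
      field_simp
      ring
    · right
      have := mul_le_mul_of_nonneg_left h.le h0.le
      rw [← sub_nonneg] at this ⊢
      refine this.trans_eq ?_
      field_simp
      ring
  calc ((Fstar n m ε)ᶜ.ncard : ℝ)
      ≤ ((univ.biUnion fun z => B 1 z ∪ B (-1) z).card : ℝ) := by
        rw [← Set.ncard_coe_finset]
        exact_mod_cast Set.ncard_le_ncard hsub (Finset.finite_toSet _)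
    _ ≤ ∑ z, (((B 1 z).card : ℝ) + (B (-1) z).card) := by
        exact_mod_cast card_biUnion_le.trans (Finset.sum_le_sum fun z _ => card_union_le _ _)
    _ ≤ ∑ _z : Bits m, ε * Fintype.card (Bits n × Bits n → Bits m) :=
        Finset.sum_le_sum fun z _ => by
          linarith [hB 1 (by simp) z, hB (-1) (by simp) z]
    _ = _ := by rw [Finset.sum_const, Finset.card_univ, nsmul_eq_mul, hβ]

theorem card_le_two_mul_ncard_Fstar {ε : ℝ} (hε0 : 0 < ε)
    (hε : ε ≤ (2 : ℝ) ^ (-(m : ℝ) - 1))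
    (hregime : Real.sqrt (3 * Real.log (2 / ε)) * (2 : ℝ) ^ (-(n : ℝ) + m / 2) < 1 / 4) :
    (Fintype.card (Bits n × Bits n → Bits m) : ℝ) ≤ 2 * (Fstar n m ε).ncard := by
  have he : 2 ^ m * ε ≤ 1 / 2 := by
    rw [Real.rpow_sub zero_lt_two, Real.rpow_neg zero_le_two, Real.rpow_natCast, Real.rpow_one]
      at hε
    calc 2 ^ m * ε ≤ 2 ^ m * (((2 : ℝ) ^ m)⁻¹ / 2) := mul_le_mul_of_nonneg_left hε (by positivity)
      _ = 1 / 2 := by field_simp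
  have h1 : ε ≤ 1 := by
    nlinarith [one_le_pow₀ (M₀ := ℝ) (a := 2) one_le_two (n := m)]
  have h2 := card_not_mem_Fstar_le hε0 h1 hregime
  have h3 : ((Fstar n m ε).ncard : ℝ) + (Fstar n m ε)ᶜ.ncard =
      Fintype.card (Bits n × Bits n → Bits m) := by
    rw [← Nat.card_eq_fintype_card]
    exact_mod_cast Set.ncard_add_ncard_compl (Fstar n m ε)
  have h4 := mul_le_mul_of_nonneg_right he
    (Nat.cast_nonneg (α := ℝ) (Fintype.card (Bits n × Bits n → Bits m)))
  linarith

end NearlyUniform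

section Soundness

variable {n m : ℕ}

theorem lt_muGamma {γ : ℝ} (hγ0 : 0 ≤ γ) (hγ1 : γ < 1 / 2) : 0.853 < muGamma γ := by
  have hb : 0 ≤ binEnt γ := by
    have h1 : Real.logb 2 γ ≤ 0 :=
      Real.logb_nonpos one_lt_two hγ0 (by linarith)
    have h2 : Real.logb 2 (1 - γ) ≤ 0 :=
      Real.logb_nonpos one_lt_two (by linarith) (by linarith)
    unfold binEnt
    nlinarith
  have h2 : (1 : ℝ) ≤ 2 ^ (γ + binEnt γ) := Real.one_le_rpow one_le_two (by linarith)
  have h3 : Real.sqrt 2 < 1.4143 := by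
    rw [Real.sqrt_lt' (by norm_num)]; norm_num
  have h4 : 0.3535 < 1 / (2 * Real.sqrt 2) := by
    rw [lt_div_iff₀ (by positivity)]; linarith
  unfold muGamma
  nlinarith

/-- The functions on which some strategy with the prescribed registers wins with probability more
than `w`. -/
def brokenBy (γ : ℝ) (n m q qAk qBk : ℕ) (w : ℝ) : Set (Bits n × Bits n → Bits m) :=
  {f | ∃ T : RoutStrategy n m q, T.qAk = qAk ∧ T.qBk = qBk ∧ w < T.win γ f}

theorem ncard_brokenBy_le {γ : ℝ} (hγ0 : 0 ≤ γ) (hγ1 : γ < 1 / 2) (hnm : m < n) (hm : m ≠ 0)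
    {Δ c : ℝ} (hΔ0 : 0 < Δ) (hmu : muGamma γ + Δ < 1) (hc1 : c < 1)
    (q qAk qBk : ℕ) :
    ((brokenBy γ n m q qAk qBk ((muGamma γ + Δ) ^ (c * (m : ℝ)) + 21 * Δ ^ m)).ncard : ℝ) ≤
      Fintype.card (Bits n × Bits n → Bits m) *
        Real.exp (2 ^ n * m * (5 * 4 ^ q * Real.log (1 / Δ) -
          2 ^ n * (Real.log ((muGamma γ + Δ) / muGamma γ) * ((muGamma γ + Δ) ^ (c * (m : ℝ)) *
            (1 - (muGamma γ + Δ) ^ (1 - c)))))) := by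
  classical
  have hμ := lt_muGamma hγ0 hγ1
  set μ := muGamma γ with hμdef
  have hμ0 : 0 < μ := by linarith
  set r := μ + Δ with hr
  have hr0 : 0 < r := by linarith
  set t := r ^ (c * (m : ℝ)) with ht
  have ht0 : 0 < t := Real.rpow_pos_of_pos hr0 _
  have hΔm : 0 < Δ ^ m := by positivity
  obtain ⟨G, hG1, hG2, hG3⟩ := exists_finset_win (n := n) (m := m) (q := q) γ hγ0 hγ1 hnm qAk qBk
    (δ := 7 / 2 * Δ ^ m) (by positivity)
  have hα : (Fintype.card (Bits n × Bits n) : ℝ) = 2 ^ (2 * n) := by simp [two_mul, pow_add]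
  have hβ : (Fintype.card (Bits m) : ℝ) = 2 ^ m := by simp
  have hD : 0 ≤ Real.log (r / μ) := Real.log_nonneg ((one_le_div hμ0).2 (by linarith))
  have hsub : brokenBy γ n m q qAk qBk (t + 21 * Δ ^ m) ⊆ ((G.biUnion fun g => univ.filter
      fun f : Bits n × Bits n → Bits m =>
        Fintype.card (Bits n × Bits n) * t ≤ ∑ p, g p (f p) : Finset _) : Set _) := by
    rintro f ⟨T, hA, hB, hw⟩
    obtain ⟨g, hg, h⟩ := hG3 T hA hB
    simp only [coe_biUnion, Set.mem_iUnion, mem_coe, mem_filter, mem_univ, true_and]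
    refine ⟨g, hg, ?_⟩
    have h' : t < (1 / 2 ^ (2 * n) : ℝ) * ∑ p, g p (f p) := by linarith [h f]
    rw [hα]
    rw [one_div, inv_mul_eq_div, lt_div_iff₀ (by positivity)] at h'
    linarith
  have hts : t * (1 - r ^ (1 - c)) ≤ t - r ^ m := by
    have h1 : r ^ m = t * r ^ ((1 - c) * (m : ℝ)) := by
      rw [ht, ← Real.rpow_add hr0, ← Real.rpow_natCast]; congr 1; ring
    have h2 : r ^ ((1 - c) * (m : ℝ)) ≤ r ^ (1 - c) := by
      refine Real.rpow_le_rpow_of_exponent_ge hr0 hmu.le ?_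
      have : (1 : ℝ) ≤ m := by exact_mod_cast Nat.one_le_iff_ne_zero.2 hm
      nlinarith
    rw [h1]
    nlinarith
  have hcount : ∀ g ∈ G, ((univ.filter fun f : Bits n × Bits n → Bits m =>
        Fintype.card (Bits n × Bits n) * t ≤ ∑ p, g p (f p)).card : ℝ) ≤
      Fintype.card (Bits n × Bits n → Bits m) *
        Real.exp (-(2 ^ n * m * (2 ^ n * (Real.log (r / μ) * (t * (1 - r ^ (1 - c))))))) := by
    intro g hg
    refine (card_filter_le_of_mean_le g (π := μ ^ m) (s := r ^ m) t (by positivity)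
      (pow_le_pow_left₀ hμ0.le (by linarith) m) (fun p => (hG2 g hg p).1)
      (fun p => (hG2 g hg p).2.1) fun p => by rw [hβ]; exact (hG2 g hg p).2.2).trans ?_
    rw [Fintype.card_fun (α := _ × _), Nat.cast_pow, hα, ← div_pow, Real.log_pow]
    refine mul_le_mul_of_nonneg_left (Real.exp_le_exp.2 (neg_le_neg ?_)) (by positivity)
    have : (0 : ℝ) ≤ 2 ^ (2 * n) * (m * Real.log (r / μ)) := by positivity
    refine le_of_eq_of_le ?_ (mul_le_mul_of_nonneg_left hts this)
    rw [two_mul, pow_add]; ring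
  have hGcard : (G.card : ℝ) ≤ Real.exp (2 ^ n * m * (5 * 4 ^ q * Real.log (1 / Δ))) := by
    have h1 : 1 + 2 / (7 / 2 * Δ ^ m) ≤ (1 / Δ) ^ m := by
      have h2 : Δ ^ m ≤ Δ := by
        simpa using pow_le_pow_of_le_one hΔ0.le (by linarith) (Nat.one_le_iff_ne_zero.2 hm)
      rw [_root_.one_div_pow, ← sub_nonneg]
      have : 1 / Δ ^ m - (1 + 2 / (7 / 2 * Δ ^ m)) = (3 / 7 - Δ ^ m) / Δ ^ m := by
        field_simp; ring
      rw [this]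
      exact div_nonneg (by linarith) hΔm.le
    refine hG1.trans ((pow_le_pow_left₀ (by positivity) h1 _).trans_eq ?_)
    rw [← pow_mul, ← Real.exp_log (show 0 < 1 / Δ by positivity), ← Real.exp_nat_mul,
      Real.exp_log (by positivity)]
    congr 1
    push_cast
    ring
  calc _ ≤ ((G.biUnion fun g => univ.filter fun f : Bits n × Bits n → Bits m =>
        Fintype.card (Bits n × Bits n) * t ≤ ∑ p, g p (f p)).card : ℝ) := by
        rw [← Set.ncard_coe_finset]
        exact_mod_cast Set.ncard_le_ncard hsub (Finset.finite_toSet _)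
    _ ≤ G.card * (Fintype.card (Bits n × Bits n → Bits m) *
        Real.exp (-(2 ^ n * m * (2 ^ n * (Real.log (r / μ) * (t * (1 - r ^ (1 - c)))))))) := by
        rw [← nsmul_eq_mul (G.card), ← Finset.sum_const]
        exact (Nat.cast_le.2 card_biUnion_le).trans
          (by push_cast; exact Finset.sum_le_sum hcount)
    _ ≤ _ := mul_le_mul_of_nonneg_right hGcard (by positivity)
    _ = _ := by rw [mul_left_comm, ← Real.exp_add, ← sub_eq_add_neg, ← mul_sub]

theorem two_rpow_sub_mul_logb {r : ℝ} (hr : 0 < r) (n : ℕ) (a : ℝ) :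
    (2 : ℝ) ^ ((n : ℝ) - a * Real.logb 2 (1 / r)) = 2 ^ n * r ^ a := by
  rw [one_div, Real.logb_inv, mul_neg, sub_neg_eq_add, Real.rpow_add zero_lt_two,
    Real.rpow_natCast, mul_comm a, Real.rpow_mul zero_le_two,
    Real.rpow_logb zero_lt_two (by norm_num) hr]

theorem mul_four_pow_lt {μ Δ c : ℝ} (hμ : 0 < μ) (hΔ0 : 0 < Δ) (hmu : μ + Δ < 1)
    (hc1 : c < 1) (q : ℕ)
    (hq : 2 * (q : ℝ) < (n : ℝ) - c * m * Real.logb 2 (1 / (μ + Δ)) +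
      Real.logb 2 ((1 - (μ + Δ) ^ ((1 : ℝ) - c)) * Real.logb 2 ((μ + Δ) / μ) /
        (8 * Real.logb 2 (1 / Δ)))) :
    8 * 4 ^ q * Real.log (1 / Δ) <
      2 ^ n * (Real.log ((μ + Δ) / μ) * ((μ + Δ) ^ (c * (m : ℝ)) * (1 - (μ + Δ) ^ (1 - c)))) := by
  have hr0 : 0 < μ + Δ := by linarith
  have hL : 0 < Real.log (1 / Δ) := Real.log_pos ((one_lt_div hΔ0).2 (by linarith))
  have hD : 0 < Real.log ((μ + Δ) / μ) := Real.log_pos ((one_lt_div hμ).2 (by linarith))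
  have hR : 0 < 1 - (μ + Δ) ^ (1 - c) :=
    sub_pos.2 (Real.rpow_lt_one hr0.le hmu (by linarith))
  have h2 : 0 < Real.log 2 := Real.log_pos one_lt_two
  have hX : (1 - (μ + Δ) ^ ((1 : ℝ) - c)) * Real.logb 2 ((μ + Δ) / μ) /
      (8 * Real.logb 2 (1 / Δ)) =
      (1 - (μ + Δ) ^ (1 - c)) * Real.log ((μ + Δ) / μ) / (8 * Real.log (1 / Δ)) := by
    unfold Real.logb; field_simp
  have h := Real.rpow_lt_rpow_of_exponent_lt one_lt_two hq
  rw [Real.rpow_add zero_lt_two, two_rpow_sub_mul_logb hr0, hX,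
    Real.rpow_logb zero_lt_two (by norm_num) (by positivity), Real.rpow_mul zero_le_two,
    Real.rpow_natCast, ← mul_div_assoc, lt_div_iff₀ (by positivity)] at h
  norm_num at h ⊢
  linarith

theorem ncard_brokenBy_le_two_rpow {γ : ℝ} (hγ0 : 0 ≤ γ) (hγ1 : γ < 1 / 2) (hnm : m < n)
    (hm : m ≠ 0) {Δ c : ℝ} (hΔ0 : 0 < Δ) (hmu : muGamma γ + Δ < 1) (hc0 : 0 < c) (hc1 : c < 1)
    {q : ℕ} (qAk qBk : ℕ)
    (hq : 8 * 4 ^ q * Real.log (1 / Δ) <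
      2 ^ n * (Real.log ((muGamma γ + Δ) / muGamma γ) * ((muGamma γ + Δ) ^ (c * (m : ℝ)) *
        (1 - (muGamma γ + Δ) ^ (1 - c))))) :
    ((brokenBy γ n m q qAk qBk ((muGamma γ + Δ) ^ (c * (m : ℝ)) + 21 * Δ ^ m)).ncard : ℝ) ≤
      Fintype.card (Bits n × Bits n → Bits m) *
        (2 : ℝ) ^ (-((m : ℝ) * (2 ^ n * (muGamma γ + Δ) ^ (c * (m : ℝ))) + 1 + 3 * n)) := by
  rcases Nat.eq_zero_or_pos q with rfl | hq0
  · have h : brokenBy γ n m 0 qAk qBk ((muGamma γ + Δ) ^ (c * (m : ℝ)) + 21 * Δ ^ m) = ∅ := by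
      ext f
      refine iff_of_false (fun ⟨T, _⟩ => ?_) (Set.notMem_empty f)
      have := T.hqA; have := T.hqB; have := T.hrA; have := T.hrB
      omega
    rw [h, Set.ncard_empty, Nat.cast_zero]
    positivity
  refine (ncard_brokenBy_le hγ0 hγ1 hnm hm hΔ0 hmu hc1 q qAk qBk).trans
    (mul_le_mul_of_nonneg_left ?_ (Nat.cast_nonneg _))
  rw [Real.rpow_def_of_pos zero_lt_two]
  refine Real.exp_le_exp.2 ?_
  have hμ := lt_muGamma hγ0 hγ1
  have hr0 : 0 < muGamma γ + Δ := by linarith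
  have ht : (muGamma γ + Δ) ^ (c * (m : ℝ)) ≤ 1 :=
    Real.rpow_le_one hr0.le hmu.le (by positivity)
  generalize (muGamma γ + Δ) ^ (c * (m : ℝ)) = t at ht hq ⊢
  generalize Real.log ((muGamma γ + Δ) / muGamma γ) * (t * (1 - (muGamma γ + Δ) ^ (1 - c))) = W
    at hq ⊢
  have h2 : 0 < Real.log 2 := Real.log_pos one_lt_two
  have hL : 2 * Real.log 2 ≤ Real.log (1 / Δ) := by
    rw [← Real.log_rpow zero_lt_two]
    refine Real.log_le_log (by positivity) ?_
    rw [le_div_iff₀ hΔ0]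
    norm_num
    linarith
  have h4 : (4 : ℝ) ≤ 4 ^ q := by
    simpa using pow_le_pow_right₀ (by norm_num : (1 : ℝ) ≤ 4) hq0
  have hm1 : (1 : ℝ) ≤ m := by exact_mod_cast Nat.one_le_iff_ne_zero.2 hm
  have hn : (n : ℝ) + 1 ≤ 2 ^ n := by exact_mod_cast Nat.lt_two_pow_self
  have h5 : 24 * Real.log 2 ≤ 3 * 4 ^ q * Real.log (1 / Δ) := by nlinarith
  have h6 : (0 : ℝ) < 2 ^ n * m := by positivity
  have h7 : (2 : ℝ) ^ n ≤ 2 ^ n * m := le_mul_of_one_le_right (by positivity) hm1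
  calc 2 ^ n * m * (5 * 4 ^ q * Real.log (1 / Δ) - 2 ^ n * W)
      ≤ 2 ^ n * m * -(24 * Real.log 2) := mul_le_mul_of_nonneg_left (by linarith) h6.le
    _ = Real.log 2 * -(24 * (2 ^ n * m)) := by ring
    _ ≤ _ := mul_le_mul_of_nonneg_left (neg_le_neg ?_) h2.le
  have h8 : (m : ℝ) * (2 ^ n * t) ≤ 2 ^ n * m := by
    rw [← mul_assoc, mul_comm (m : ℝ)]; exact mul_le_of_le_one_right h6.le ht
  linarith

theorem lt_of_mul_four_pow_lt {γ : ℝ} (hγ0 : 0 ≤ γ) (hγ1 : γ < 1 / 2) {Δ c : ℝ} (hΔ0 : 0 < Δ)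
    (hmu : muGamma γ + Δ < 1) (hc0 : 0 < c) (hc1 : c < 1) {q : ℕ}
    (hq : 8 * 4 ^ q * Real.log (1 / Δ) <
      2 ^ n * (Real.log ((muGamma γ + Δ) / muGamma γ) * ((muGamma γ + Δ) ^ (c * (m : ℝ)) *
        (1 - (muGamma γ + Δ) ^ (1 - c))))) : q < n := by
  have hμ := lt_muGamma hγ0 hγ1
  have hr0 : 0 < muGamma γ + Δ := by linarith
  have hD : Real.log ((muGamma γ + Δ) / muGamma γ) ≤ Real.log (1 / Δ) := by
    refine Real.log_le_log (by positivity) ?_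
    rw [div_le_div_iff₀ (by linarith) hΔ0]
    nlinarith
  have hD0 : 0 ≤ Real.log ((muGamma γ + Δ) / muGamma γ) :=
    Real.log_nonneg ((one_le_div (by linarith)).2 (by linarith))
  have hL : 0 < Real.log (1 / Δ) := Real.log_pos ((one_lt_div hΔ0).2 (by linarith))
  have ht : (muGamma γ + Δ) ^ (c * (m : ℝ)) ≤ 1 :=
    Real.rpow_le_one hr0.le hmu.le (by positivity)
  have ht0 : 0 ≤ (muGamma γ + Δ) ^ (c * (m : ℝ)) := by positivity
  have hR0 : 0 ≤ (muGamma γ + Δ) ^ (1 - c) := by positivity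
  have hR1 : (muGamma γ + Δ) ^ (1 - c) ≤ 1 := Real.rpow_le_one hr0.le hmu.le (by linarith)
  have h1 : (muGamma γ + Δ) ^ (c * (m : ℝ)) * (1 - (muGamma γ + Δ) ^ (1 - c)) ≤ 1 :=
    mul_le_one₀ ht (by linarith) (by linarith)
  have h2 : 8 * 4 ^ q * Real.log (1 / Δ) < 2 ^ n * Real.log (1 / Δ) :=
    hq.trans_le (mul_le_mul_of_nonneg_left ((mul_le_of_le_one_right hD0 h1).trans hD)
      (by positivity))
  have h3 : (8 : ℝ) * 4 ^ q < 2 ^ n := lt_of_mul_lt_mul_right h2 hL.le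
  have h4 : (2 : ℝ) ^ q ≤ 4 ^ q := pow_le_pow_left₀ zero_le_two (by norm_num) q
  have h5 : (0 : ℝ) < 4 ^ q := by positivity
  exact (pow_lt_pow_iff_right₀ (one_lt_two (α := ℝ))).1 (by linarith)

end Soundness

/-- parallel repetition soundness of `QPV_rout^{f:n→m}` in the bounded
entanglement model, for a uniformly random `f ∈ F*_ε`. -/
theorem stmt14 (γ : ℝ) (hγ0 : 0 ≤ γ) (hγ1 : γ < 1 / 2) (n m : ℕ) (hnm : n > m)
    (ε Δ c : ℝ) (hε0 : 0 < ε) (hε : ε ≤ (2 : ℝ) ^ (-(m : ℝ) - 1))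
    (hΔ0 : 0 < Δ) (hΔ1 : Δ < 1) (hmu : muGamma γ + Δ < 1)
    (hc0 : 0 < c) (hc1 : c < 1)
    (hregime : Real.sqrt (3 * Real.log (2 / ε)) * (2 : ℝ) ^ (-(n : ℝ) + m / 2) < 1 / 4) :
    (1 - (2 : ℝ) ^ (-(m : ℝ) *
          (2 : ℝ) ^ ((n : ℝ) - c * m * Real.logb 2 (1 / (muGamma γ + Δ))))) *
        ((Fstar n m ε).ncard : ℝ) ≤
      (({f ∈ Fstar n m ε |
          ∀ q : ℕ,
            2 * (q : ℝ) < (n : ℝ) - c * m * Real.logb 2 (1 / (muGamma γ + Δ)) +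
                Real.logb 2 ((1 - (muGamma γ + Δ) ^ ((1 : ℝ) - c)) *
                  Real.logb 2 ((muGamma γ + Δ) / muGamma γ) /
                    (8 * Real.logb 2 (1 / Δ))) →
              ∀ T : RoutStrategy n m q,
                T.win γ f ≤ (muGamma γ + Δ) ^ (c * (m : ℝ)) *
                    (1 + 3 * Real.sqrt (3 * Real.log (2 / ε)) *
                      (2 : ℝ) ^ (-(n : ℝ) + m / 2)) +
                  21 * Δ ^ m}).ncard : ℝ) := by
  classical
  rcases eq_or_ne m 0 with rfl | hm
  · simp
  have hμ := lt_muGamma hγ0 hγ1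
  have hr0 : 0 < muGamma γ + Δ := by linarith
  set t := (muGamma γ + Δ) ^ (c * (m : ℝ)) with ht
  have ht0 : 0 < t := Real.rpow_pos_of_pos hr0 _
  rw [two_rpow_sub_mul_logb hr0, ← ht, neg_mul]
  set good := {f ∈ Fstar n m ε | _} with hgood
  set Q := (Finset.range n).filter fun q => 8 * 4 ^ q * Real.log (1 / Δ) <
    2 ^ n * (Real.log ((muGamma γ + Δ) / muGamma γ) *
      (t * (1 - (muGamma γ + Δ) ^ (1 - c)))) with hQ
  set I := Q ×ˢ (Finset.range n ×ˢ Finset.range n) with hI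
  have hsub : Fstar n m ε \ good ⊆ ⋃ i ∈ I, brokenBy γ n m i.1 i.2.1 i.2.2 (t + 21 * Δ ^ m) := by
    rintro f ⟨hf, hf'⟩
    simp only [hgood, Set.mem_ofPred_eq, not_and, not_forall, not_le] at hf'
    obtain ⟨q, hq, T, hT⟩ := hf' hf
    have hq' := mul_four_pow_lt (by linarith) hΔ0 hmu hc1 q hq
    have hqn := lt_of_mul_four_pow_lt hγ0 hγ1 hΔ0 hmu hc0 hc1 hq'
    have hA := T.hqA
    have hB := T.hqB
    simp only [Set.mem_iUnion]
    refine ⟨(q, T.qAk, T.qBk), ?_, T, rfl, rfl, lt_of_le_of_lt ?_ hT⟩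
    · simp only [hI, hQ, Finset.mem_product, Finset.mem_filter, Finset.mem_range]
      exact ⟨⟨hqn, hq'⟩, by omega, by omega⟩
    · exact add_le_add_left (le_mul_of_one_le_right ht0.le
        (le_add_of_nonneg_right (by positivity))) _
  have hcardI : (I.card : ℝ) ≤ 2 ^ (3 * n) := by
    have h : I.card ≤ 2 ^ n * (2 ^ n * 2 ^ n) := by
      rw [hI, Finset.card_product, Finset.card_product, Finset.card_range]
      have hn : n ≤ 2 ^ n := Nat.lt_two_pow_self.le
      exact Nat.mul_le_mul (((Finset.card_filter_le _ _).trans_eq (Finset.card_range n)).trans hn)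
        (Nat.mul_le_mul hn hn)
    calc (I.card : ℝ) ≤ 2 ^ n * (2 ^ n * 2 ^ n) := by exact_mod_cast h
      _ = 2 ^ (3 * n) := by ring
  have hbad : ((Fstar n m ε \ good).ncard : ℝ) ≤
      (2 : ℝ) ^ (-((m : ℝ) * (2 ^ n * t))) * (Fstar n m ε).ncard := by
    calc ((Fstar n m ε \ good).ncard : ℝ)
        ≤ ∑ i ∈ I, ((brokenBy γ n m i.1 i.2.1 i.2.2 (t + 21 * Δ ^ m)).ncard : ℝ) := by
          exact_mod_cast (Set.ncard_le_ncard hsub (Set.toFinite _)).trans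
            (Finset.set_ncard_biUnion_le _ _)
      _ ≤ ∑ i ∈ I, (Fintype.card (Bits n × Bits n → Bits m) *
          (2 : ℝ) ^ (-((m : ℝ) * (2 ^ n * t) + 1 + 3 * n)) : ℝ) :=
          Finset.sum_le_sum fun i hi => ncard_brokenBy_le_two_rpow hγ0 hγ1 hnm hm hΔ0 hmu hc0 hc1
            i.2.1 i.2.2 (Finset.mem_filter.1 (Finset.mem_product.1 hi).1).2
      _ = I.card * (Fintype.card (Bits n × Bits n → Bits m) *
          (2 : ℝ) ^ (-((m : ℝ) * (2 ^ n * t) + 1 + 3 * n)) : ℝ) := by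
          rw [Finset.sum_const, nsmul_eq_mul]
      _ ≤ 2 ^ (3 * n) * (2 * (Fstar n m ε).ncard *
          (2 : ℝ) ^ (-((m : ℝ) * (2 ^ n * t) + 1 + 3 * n)) : ℝ) := by
          gcongr
          exact card_le_two_mul_ncard_Fstar hε0 hε hregime
      _ = _ := by
          have h : (2 : ℝ) ^ (-((m : ℝ) * (2 ^ n * t) + 1 + 3 * n)) =
              2 ^ (-((m : ℝ) * (2 ^ n * t))) / 2 / 2 ^ (3 * n) := by
            rw [neg_add, neg_add, ← sub_eq_add_neg, ← sub_eq_add_neg, Real.rpow_sub zero_lt_two,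
              Real.rpow_sub zero_lt_two, Real.rpow_one, ← Real.rpow_natCast 2 (3 * n)]
            push_cast
            rfl
          rw [h]
          field_simp
  have hsum : (good.ncard : ℝ) + (Fstar n m ε \ good).ncard = (Fstar n m ε).ncard := by
    have : good ⊆ Fstar n m ε := fun f hf => hf.1
    rw [add_comm]
    exact_mod_cast Set.ncard_sdiff_add_ncard_of_subset this (Set.toFinite _)
  linarith
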